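/- arXiv:2312.02749 — 2 statements merged into one kernel-verified Lean document; each statement's English description precedes it below -/
import Mathlib

section
/- For positive integers L, N, M, the following identity holds in ℤ[[q]]: Σ_{μ : ℓ(μ) ≤ L, μ₁ ≤ N} (−1)^{|μ|} · q^{M|μ| + Σ_{(i,j)∈μ} h(i,j)} · ∏_{(i,j)∈μ} (1 − q^{L+c(i,j)})(1 − q^{N−c(i,j)}) / (1 − q^{h(i,j)})² = ∏_{1≤n≤N} ∏_{1≤l≤L} (1 − q^{n+l+M−1}), where the (finite) sum is over all partitions μ whose Young diagram fits in the L×N rectangle. (This is the specialization of the dual Cauchy identity Σ_μ s_μ(q^{−ρ}|_L) · q^{M|μ|} · s_{μᵗ}(−q^{−ρ}|_N) = ∏_{n,l}(1 − q^{n+l+M−1}), rewritten via the hook-content formula for principal specializations of Schur functions.) -/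
open Finset PowerSeries

noncomputable section

/-- Parts of a partition, 0-indexed: `μ i` is the `(i+1)`-st part `μ_{i+1}`. -/
def IsPartition (μ : ℕ → ℕ) : Prop := Antitone μ ∧ ∃ n, μ n = 0

/-- Conjugate partition, 0-indexed: `conj μ j = μᵗ_{j+1} = #{i : μ_i ≥ j+1}`. -/
def conj (μ : ℕ → ℕ) (j : ℕ) : ℕ := Set.ncard {i | j + 1 ≤ μ i}

/-- Cells of the Young diagram of `μ`, 0-indexed: `(i, j)` is the cell in row `i+1`,
column `j+1`. -/
def cells (μ : ℕ → ℕ) : Finset (ℕ × ℕ) :=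
  (range (conj μ 0) ×ˢ range (μ 0)).filter fun p => p.2 < μ p.1

/-- Hook length of the (0-indexed) cell `p` of `μ`:
`h(i+1, j+1) = μ_{i+1} + μᵗ_{j+1} - (i+1) - (j+1) + 1`. -/
def hook (μ : ℕ → ℕ) (p : ℕ × ℕ) : ℕ := μ p.1 + conj μ p.2 - (p.1 + p.2 + 1)

open scoped Classical

/-- Extend a tuple `f : Fin L → Fin (N+1)` to a candidate partition `ℕ → ℕ`
(parts `≤ N`, at most `L` nonzero parts). -/
def extFun (L N : ℕ) (f : Fin L → Fin (N + 1)) : ℕ → ℕ :=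
  fun i => if h : i < L then (f ⟨i, h⟩ : ℕ) else 0

theorem vand_append {R : Type*} [CommRing R] (L N : ℕ) (x : Fin L → R) (y : Fin N → R) :
    (Matrix.vandermonde (Fin.append x y)).det =
      (Matrix.vandermonde x).det * (Matrix.vandermonde y).det * ∏ i, ∏ j, (y j - x i) := by
  have key : ∀ (n : ℕ) (v : Fin n → R), (Matrix.vandermonde v).det =
      ∏ i, ∏ j, if i < j then v j - v i else 1 := by
    intro n v
    rw [Matrix.det_vandermonde]
    refine Finset.prod_congr rfl fun i _ => ?_
    rw [← Finset.prod_filter]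
    congr 1
    ext j; simp
  have h1 : ∀ (j : Fin N) (i : Fin L), ¬ (Fin.natAdd L j < Fin.castAdd N i) := by
    intro j i h
    have := Fin.lt_def.1 h
    simp at this
    omega
  have h2 : ∀ (j : Fin N) (i : Fin L), (Fin.castAdd N i < Fin.natAdd L j) := by
    intro j i
    rw [Fin.lt_def]
    simp
    omega
  rw [key, key, key, Fin.prod_univ_add]
  simp only [Fin.prod_univ_add, Fin.append_left, Fin.append_right, h1, h2, if_true, if_false,
    Finset.prod_const_one, one_mul, Finset.prod_mul_distrib]
  simp only [Fin.lt_def, Fin.val_castAdd, Fin.val_natAdd, add_lt_add_iff_left]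
  ring

/-- block matrix -/
def blk {R : Type*} [CommRing R] (L N : ℕ) (a c : Fin (L+N) → R) (S : Finset (Fin (L+N))) :
    Matrix (Fin (L+N)) (Fin (L+N)) R :=
  Matrix.of <| S.piecewise (fun s => Fin.append (fun k : Fin L => c s * a s ^ (k:ℕ)) (fun _ : Fin N => 0))
   (fun s => Fin.append (fun _ : Fin L => 0) (fun k : Fin N => a s ^ (k:ℕ)))

theorem blk_sum {R : Type*} [CommRing R] (L N : ℕ) (a c : Fin (L+N) → R) :
    Matrix.det (Matrix.of fun s => Fin.append (fun k : Fin L => c s * a s ^ (k:ℕ))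
      (fun k : Fin N => a s ^ (k:ℕ))) = ∑ S, (blk L N a c S).det := by
  have := (Matrix.detRowAlternating (n := Fin (L+N)) (R := R)).toMultilinearMap.map_add_univ
    (fun s => Fin.append (fun k : Fin L => c s * a s ^ (k:ℕ)) (fun _ : Fin N => 0))
    (fun s => Fin.append (fun _ : Fin L => 0) (fun k : Fin N => a s ^ (k:ℕ)))
  refine Eq.trans ?_ this
  show Matrix.det _ = Matrix.det _
  congr 1
  ext s i
  refine Fin.addCases (fun i => ?_) (fun i => ?_) i <;> simp

theorem blk_zero {R : Type*} [CommRing R] (L N : ℕ) (a c : Fin (L+N) → R) (S : Finset (Fin (L+N)))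
    (h : (blk L N a c S).det ≠ 0) : S.card = L := by
  rw [Matrix.det_apply] at h
  obtain ⟨σ, -, hσ⟩ := Finset.exists_ne_zero_of_sum_ne_zero h
  have h2 : ∀ i, blk L N a c S (σ i) i ≠ 0 := by
    intro i hi
    apply hσ
    have := Finset.prod_eq_zero (f := fun i => blk L N a c S (σ i) i) (Finset.mem_univ i) hi
    rw [this, smul_zero]
  have h3 : S = Finset.univ.image (fun i : Fin L => σ (Fin.castAdd N i)) := by
    ext s
    obtain ⟨i, rfl⟩ := σ.surjective s
    have := h2 i
    revert this
    refine Fin.addCases (fun i => ?_) (fun i => ?_) i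
    · by_cases hs : σ (Fin.castAdd N i) ∈ S <;> simp [blk, hs]
    · have : ∀ j : Fin L, Fin.castAdd N j ≠ Fin.natAdd L i := by
        intro j hj
        have := congrArg Fin.val hj
        simp at this
        omega
      by_cases hs : σ (Fin.natAdd L i) ∈ S <;> simp [blk, hs, this]
  rw [h3, Finset.card_image_of_injective _ (fun x y h => Fin.castAdd_injective L N (σ.injective h))]
  simp

theorem blk_eval {R : Type*} [CommRing R] (L N : ℕ) (a c : Fin (L+N) → R) (S : Finset (Fin (L+N)))
    (e : Equiv.Perm (Fin (L+N))) (h1 : ∀ i, e (Fin.castAdd N i) ∈ S)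
    (h2 : ∀ j, e (Fin.natAdd L j) ∉ S) :
    (blk L N a c S).det * ∏ i : Fin L, ∏ j : Fin N, (a (e (Fin.natAdd L j)) - a (e (Fin.castAdd N i)))
      = (∏ i : Fin L, c (e (Fin.castAdd N i))) * (Matrix.vandermonde a).det := by
  have hb : ((blk L N a c S).submatrix e id).det =
      (∏ i : Fin L, c (e (Fin.castAdd N i))) *
      (Matrix.vandermonde (fun i => a (e (Fin.castAdd N i)))).det *
      (Matrix.vandermonde (fun j => a (e (Fin.natAdd L j)))).det := by
    rw [← Matrix.det_submatrix_equiv_self finSumFinEquiv]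
    have : (((blk L N a c S).submatrix e id).submatrix finSumFinEquiv finSumFinEquiv) =
      Matrix.fromBlocks (Matrix.of fun i j => c (e (Fin.castAdd N i)) *
          (Matrix.vandermonde (fun i => a (e (Fin.castAdd N i)))) i j) 0 0
        (Matrix.vandermonde (fun j => a (e (Fin.natAdd L j)))) := by
      ext i j
      rcases i with i | i <;> rcases j with j | j <;>
        simp [blk, h1, h2, Matrix.vandermonde_apply]
    rw [this, Matrix.det_fromBlocks_zero₂₁, Matrix.det_mul_column]
  have hv : ((Matrix.vandermonde a).submatrix e id).det =
      (Matrix.vandermonde (fun i => a (e (Fin.castAdd N i)))).det *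
      (Matrix.vandermonde (fun j => a (e (Fin.natAdd L j)))).det *
      ∏ i : Fin L, ∏ j : Fin N, (a (e (Fin.natAdd L j)) - a (e (Fin.castAdd N i))) := by
    rw [← vand_append]
    congr 1
    ext i j
    refine Fin.addCases (fun i => ?_) (fun i => ?_) i <;> simp [Matrix.vandermonde_apply]
  rw [Matrix.det_permute] at hb hv
  have hs : ((Equiv.Perm.sign e : ℤˣ) : R) * ((Equiv.Perm.sign e : ℤˣ) : R) = 1 := by
    rcases Int.units_eq_one_or (Equiv.Perm.sign e) with h | h <;> simp [h]
  set sg : R := ((Equiv.Perm.sign e : ℤˣ) : R)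
  set P := ∏ i : Fin L, ∏ j : Fin N, (a (e (Fin.natAdd L j)) - a (e (Fin.castAdd N i)))
  linear_combination (-(blk L N a c S).det * P + (∏ i : Fin L, c (e (Fin.castAdd N i))) * (Matrix.vandermonde a).det) * hs + sg * P * hb - sg * (∏ i : Fin L, c (e (Fin.castAdd N i))) * hv

theorem lt_conj (L : ℕ) (μ : ℕ → ℕ) (h : Antitone μ) (h0 : μ L = 0) (i j : ℕ) :
    i < conj μ j ↔ j < μ i := by
  have hex : ∃ i, μ i ≤ j := ⟨L, by omega⟩
  have : {i | j + 1 ≤ μ i} = Set.Iio (Nat.find hex) := by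
    ext k
    simp only [Set.mem_ofPred_eq, Set.mem_Iio, Nat.lt_find_iff]
    constructor
    · intro hk m hm
      have := h hm
      omega
    · intro hk
      have := hk k le_rfl
      omega
  have hc : conj μ j = Nat.find hex := by
    rw [conj, this, ← Finset.coe_Iio, Set.ncard_coe_finset, Nat.card_Iio]
  rw [hc, Nat.lt_find_iff]
  constructor
  · intro hk
    have := hk i le_rfl
    omega
  · intro hk m hm
    have := h hm
    omega

def sS (L : ℕ) (μ : ℕ → ℕ) (i : ℕ) : ℕ := μ i + (L - 1 - i)
def tT (L : ℕ) (μ : ℕ → ℕ) (j : ℕ) : ℕ := L + j - conj μ j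

structure Good (L N : ℕ) (μ : ℕ → ℕ) : Prop where
  anti : Antitone μ
  zero : ∀ i, L ≤ i → μ i = 0
  le : ∀ i, μ i ≤ N

theorem Good.conj_le {L N : ℕ} {μ : ℕ → ℕ} (h : Good L N μ) (j : ℕ) : conj μ j ≤ L := by
  by_contra hh
  have := (lt_conj L μ h.anti (h.zero L le_rfl) L j).1 (by omega)
  rw [h.zero L le_rfl] at this
  omega

theorem Good.cmp {L N : ℕ} {μ : ℕ → ℕ} (h : Good L N μ) {i j : ℕ} (hi : i < L) :
    (j < μ i ∧ tT L μ j < sS L μ i ∧ sS L μ i - tT L μ j = hook μ (i, j)) ∨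
    (μ i ≤ j ∧ sS L μ i < tT L μ j) := by
  have h1 := lt_conj L μ h.anti (h.zero L le_rfl) i j
  have h2 := h.conj_le j
  unfold tT sS hook
  dsimp only
  by_cases hj : j < μ i
  · have := h1.2 hj
    left; refine ⟨hj, ?_, ?_⟩ <;> omega
  · have : ¬ i < conj μ j := fun h => hj (h1.1 h)
    right; constructor <;> omega

theorem Good.s_lt {L N : ℕ} {μ : ℕ → ℕ} (h : Good L N μ) {i : ℕ} (hi : i < L) :
    sS L μ i < L + N := by
  have := h.le i
  unfold sS; omega

theorem Good.t_lt {L N : ℕ} {μ : ℕ → ℕ} (_h : Good L N μ) {j : ℕ} (hj : j < N) :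
    tT L μ j < L + N := by
  unfold tT; omega

theorem Good.s_anti {L N : ℕ} {μ : ℕ → ℕ} (h : Good L N μ) {i k : ℕ} (hi : i < k) (hk : k < L) :
    sS L μ k < sS L μ i := by
  have := h.anti hi.le
  unfold sS; omega

theorem Good.conj_anti {L N : ℕ} {μ : ℕ → ℕ} (h : Good L N μ) {i k : ℕ} (hi : i < k) :
    conj μ k ≤ conj μ i := by
  by_contra hh
  have h1 := lt_conj L μ h.anti (h.zero L le_rfl) (conj μ i) k
  have h2 := lt_conj L μ h.anti (h.zero L le_rfl) (conj μ i) i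
  omega

theorem Good.t_mono {L N : ℕ} {μ : ℕ → ℕ} (h : Good L N μ) {i k : ℕ} (hi : i < k) :
    tT L μ i < tT L μ k := by
  have := h.conj_anti hi
  have := h.conj_le i
  unfold tT; omega

def Good.fn {L N : ℕ} {μ : ℕ → ℕ} (h : Good L N μ) : Fin (L+N) → Fin (L+N) :=
  Fin.append (fun i : Fin L => ⟨sS L μ i, h.s_lt i.2⟩) (fun j : Fin N => ⟨tT L μ j, h.t_lt j.2⟩)

theorem Good.fn_inj {L N : ℕ} {μ : ℕ → ℕ} (h : Good L N μ) : Function.Injective h.fn := by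
  intro x y
  refine Fin.addCases (fun i => ?_) (fun i => ?_) x <;>
  refine Fin.addCases (fun j => ?_) (fun j => ?_) y <;> 
  simp only [Good.fn, Fin.append_left, Fin.append_right, Fin.mk.injEq] <;> intro hxy
  · rcases lt_trichotomy (i:ℕ) j with hh | hh | hh
    · have := h.s_anti hh j.2; omega
    · rw [Fin.ext hh]
    · have := h.s_anti hh i.2; omega
  · rcases h.cmp (i := i) (j := j) i.2 with hh | hh <;> omega
  · rcases h.cmp (i := j) (j := i) j.2 with hh | hh <;> omega
  · rcases lt_trichotomy (i:ℕ) j with hh | hh | hh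
    · have := h.t_mono hh; omega
    · rw [Fin.ext hh]
    · have := h.t_mono hh; omega

def Good.perm {L N : ℕ} {μ : ℕ → ℕ} (h : Good L N μ) : Equiv.Perm (Fin (L+N)) :=
  Equiv.ofBijective h.fn (Finite.injective_iff_bijective.1 h.fn_inj)

theorem Good.prod {L N : ℕ} {μ : ℕ → ℕ} (h : Good L N μ) {R : Type*} [CommMonoid R] (F : ℕ → R) :
    ∏ u ∈ range (L+N), F u = (∏ k ∈ range L, F (sS L μ k)) * ∏ j ∈ range N, F (tT L μ j) := by
  rw [Finset.prod_range, ← Equiv.prod_comp h.perm, Fin.prod_univ_add, Finset.prod_range, Finset.prod_range]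
  simp [Good.perm, Good.fn]

theorem Good.mem_cells {L N : ℕ} {μ : ℕ → ℕ} (h : Good L N μ) (p : ℕ × ℕ) :
    p ∈ cells μ ↔ p.2 < μ p.1 := by
  have := lt_conj L μ h.anti (h.zero L le_rfl) p.1 0
  have := h.anti (Nat.zero_le p.1)
  simp only [cells, mem_filter, mem_product, mem_range]
  omega

theorem Good.prod_cells {L N : ℕ} {μ : ℕ → ℕ} (h : Good L N μ) {R : Type*} [CommMonoid R]
    (F : ℕ × ℕ → R) :
    ∏ p ∈ cells μ, F p = ∏ i ∈ range L, ∏ j ∈ range (μ i), F (i, j) := by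
  apply Finset.prod_finset_product
  intro p
  rw [h.mem_cells]
  simp only [mem_range]
  have := h.zero p.1
  omega

theorem Good.prod_cells' {L N : ℕ} {μ : ℕ → ℕ} (h : Good L N μ) {R : Type*} [CommMonoid R]
    (F : ℕ × ℕ → R) :
    ∏ p ∈ cells μ, F p = ∏ i ∈ range L, ∏ j ∈ range N,
      if tT L μ j < sS L μ i then F (i, j) else 1 := by
  rw [h.prod_cells]
  refine Finset.prod_congr rfl fun i hi => ?_
  rw [← Finset.prod_filter]
  refine Finset.prod_congr ?_ fun _ _ => rfl
  ext j
  have := h.le i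
  simp only [mem_range, mem_filter] at hi ⊢
  rcases h.cmp (i := i) (j := j) hi with hh | hh <;> omega

abbrev gq (n : ℕ) : PowerSeries ℤ := 1 - (X : PowerSeries ℤ) ^ n
def GQ (n : ℕ) : PowerSeries ℤ := ∏ k ∈ range n, gq (k+1)

theorem gq_unit {n : ℕ} (h : 0 < n) : IsUnit (gq n) := by
  rw [PowerSeries.isUnit_iff_constantCoeff]
  simp [h.ne']

theorem GQ_unit (n : ℕ) : IsUnit (GQ n) := by
  rw [GQ, IsUnit.prod_iff]
  exact fun k _ => gq_unit (by omega)

theorem GQ_add (a b : ℕ) : GQ (a+b) = GQ a * ∏ k ∈ range b, gq (a + k + 1) := by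
  rw [GQ, Finset.prod_range_add]; rfl

theorem GQ_desc (a b : ℕ) (h : b ≤ a) : GQ a = GQ (a - b) * ∏ k ∈ range b, gq (a - k) := by
  obtain ⟨c, rfl⟩ := Nat.exists_eq_add_of_le' h
  rw [GQ_add, Nat.add_sub_cancel, ← Finset.prod_range_reflect]
  congr 1
  refine Finset.prod_congr rfl fun k hk => ?_
  rw [mem_range] at hk
  congr 2
  omega

def Hp (L N : ℕ) (μ : ℕ → ℕ) : PowerSeries ℤ := ∏ i ∈ range L, ∏ j ∈ range N,
  if tT L μ j < sS L μ i then gq (sS L μ i - tT L μ j) else 1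
def Hn (L N : ℕ) (μ : ℕ → ℕ) : PowerSeries ℤ := ∏ i ∈ range L, ∏ j ∈ range N,
  if sS L μ i < tT L μ j then gq (tT L μ j - sS L μ i) else 1
def Dp (L : ℕ) (μ : ℕ → ℕ) : PowerSeries ℤ := ∏ i ∈ range L, ∏ j ∈ range L,
  if sS L μ j < sS L μ i then gq (sS L μ i - sS L μ j) else 1

theorem Dp_unit (L : ℕ) (μ : ℕ → ℕ) : IsUnit (Dp L μ) := by
  rw [Dp, IsUnit.prod_iff]
  intro i _
  rw [IsUnit.prod_iff]
  intro j _
  split_ifs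
  · exact gq_unit (by omega)
  · exact isUnit_one

theorem Good.row1 {L N : ℕ} {μ : ℕ → ℕ} (h : Good L N μ) :
    Dp L μ * Hp L N μ = ∏ i ∈ range L, GQ (sS L μ i) := by
  rw [Dp, Hp, ← Finset.prod_mul_distrib]
  refine Finset.prod_congr rfl fun i hi => ?_
  rw [← h.prod (fun u => if u < sS L μ i then gq (sS L μ i - u) else 1), ← Finset.prod_filter,
    GQ, ← Finset.prod_range_reflect]
  have := h.s_lt (mem_range.1 hi)
  refine Finset.prod_congr ?_ fun k hk => ?_
  · ext; simp; omega
  · rw [mem_range] at hk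
    congr 2; omega

theorem Good.row2 {L N : ℕ} {μ : ℕ → ℕ} (h : Good L N μ) :
    Dp L μ * Hn L N μ = ∏ i ∈ range L, GQ (L + N - 1 - sS L μ i) := by
  rw [Dp, Finset.prod_comm, Hn, ← Finset.prod_mul_distrib]
  refine Finset.prod_congr rfl fun i hi => ?_
  rw [← h.prod (fun u => if sS L μ i < u then gq (u - sS L μ i) else 1)]
  have := h.s_lt (mem_range.1 hi)
  obtain ⟨c, hc⟩ : ∃ c, L + N = (sS L μ i + 1) + c := ⟨L + N - (sS L μ i + 1), by omega⟩
  rw [hc, Finset.prod_range_add, Finset.prod_eq_one, one_mul, GQ]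
  · have : sS L μ i + 1 + c - 1 - sS L μ i = c := by omega
    rw [this]
    refine Finset.prod_congr rfl fun k hk => ?_
    rw [if_pos (by omega)]
    congr 2; omega
  · intro u hu
    rw [mem_range] at hu
    rw [if_neg (by omega)]

theorem Good.cont1 {L N : ℕ} {μ : ℕ → ℕ} (h : Good L N μ) :
    (∏ i ∈ range L, GQ i) * ∏ p ∈ cells μ, gq (L + p.2 - p.1) = ∏ i ∈ range L, GQ (sS L μ i) := by
  rw [h.prod_cells, ← Finset.prod_range_reflect, ← Finset.prod_mul_distrib]
  refine Finset.prod_congr rfl fun i hi => ?_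
  rw [mem_range] at hi
  rw [sS, add_comm (μ i), GQ_add]
  congr 1
  refine Finset.prod_congr rfl fun k hk => ?_
  congr 2; dsimp only; omega

theorem Good.cont2 {L N : ℕ} {μ : ℕ → ℕ} (h : Good L N μ) :
    (∏ i ∈ range L, GQ (L + N - 1 - sS L μ i)) * ∏ p ∈ cells μ, gq (N + p.1 - p.2)
      = ∏ i ∈ range L, GQ (N + i) := by
  rw [h.prod_cells, ← Finset.prod_mul_distrib]
  refine Finset.prod_congr rfl fun i hi => ?_
  rw [mem_range] at hi
  have := h.le i
  rw [GQ_desc (N + i) (μ i) (by omega)]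
  congr 2
  unfold sS; omega

def Q0 (L N : ℕ) : PowerSeries ℤ := ∏ i ∈ range L, ∏ j ∈ range N, gq (i + j + 1)

theorem Q0_eq (L N : ℕ) : (∏ i ∈ range L, GQ i) * Q0 L N = ∏ i ∈ range L, GQ (N + i) := by
  rw [Q0, ← Finset.prod_mul_distrib]
  refine Finset.prod_congr rfl fun i hi => ?_
  rw [add_comm N, GQ_add]

theorem Good.main {L N : ℕ} {μ : ℕ → ℕ} (h : Good L N μ) :
    (∏ p ∈ cells μ, gq (L + p.2 - p.1)) * (∏ p ∈ cells μ, gq (N + p.1 - p.2)) * Hn L N μ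
      = Q0 L N * Hp L N μ := by
  have hu : IsUnit ((∏ i ∈ range L, GQ i) * Dp L μ) := by
    refine IsUnit.mul ?_ (Dp_unit _ _)
    rw [IsUnit.prod_iff]
    exact fun i _ => GQ_unit i
  apply hu.mul_left_cancel
  have h1 := h.row1
  have h2 := h.row2
  have h3 := h.cont1
  have h4 := h.cont2
  have h5 := Q0_eq L N
  rw [← h1] at h3
  rw [← h2, ← h5] at h4
  linear_combination (Dp L μ * (∏ p ∈ cells μ, gq (N + p.1 - p.2)) * Hn L N μ) * h3
    + Hp L N μ * Dp L μ * h4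

def PP (L N : ℕ) (μ : ℕ → ℕ) : PowerSeries ℤ := ∏ i ∈ range L, ∏ j ∈ range N,
  ((X : PowerSeries ℤ) ^ tT L μ j - X ^ sS L μ i)
def P0 (L N : ℕ) : PowerSeries ℤ := ∏ i ∈ range L, ∏ j ∈ range N,
  ((X : PowerSeries ℤ) ^ (L + j) - X ^ i)
def E0 (L N : ℕ) : PowerSeries ℤ := ∏ i ∈ range L, ∏ j ∈ range N,
  ((-1) * (X : PowerSeries ℤ) ^ (L - 1 - i))

theorem P0_eq (L N : ℕ) : P0 L N = E0 L N * Q0 L N := by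
  rw [P0, E0, Q0, ← Finset.prod_range_reflect, ← Finset.prod_mul_distrib]
  refine Finset.prod_congr rfl fun i hi => ?_
  rw [← Finset.prod_mul_distrib]
  refine Finset.prod_congr rfl fun j hj => ?_
  rw [mem_range] at hi
  have : L + j = (L - 1 - i) + (i + j + 1) := by omega
  rw [this, pow_add]; ring

theorem Good.cells_const {L N : ℕ} {μ : ℕ → ℕ} (h : Good L N μ) (z : PowerSeries ℤ) :
    ∏ _p ∈ cells μ, z = z ^ (∑ i ∈ range L, μ i) := by
  rw [h.prod_cells, ← Finset.prod_pow_eq_pow_sum]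
  simp

theorem Good.Hp_eq {L N : ℕ} {μ : ℕ → ℕ} (h : Good L N μ) :
    ∏ p ∈ cells μ, gq (hook μ p) = Hp L N μ := by
  rw [h.prod_cells', Hp]
  refine Finset.prod_congr rfl fun i hi => Finset.prod_congr rfl fun j hj => ?_
  rcases h.cmp (i := i) (j := j) (mem_range.1 hi) with hh | hh
  · rw [hh.2.2]
  · rw [if_neg (by omega), if_neg (by omega)]

theorem Good.E_eq {L N : ℕ} {μ : ℕ → ℕ} (_h : Good L N μ) :
    ∏ i ∈ range L, ∏ j ∈ range N, ((-1) * (X : PowerSeries ℤ) ^ (sS L μ i)) =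
      E0 L N * X ^ (N * ∑ i ∈ range L, μ i) := by
  rw [E0, mul_comm N, pow_mul, ← Finset.prod_pow_eq_pow_sum, ← Finset.prod_pow,
    ← Finset.prod_mul_distrib]
  refine Finset.prod_congr rfl fun i hi => ?_
  rw [Finset.prod_const, Finset.prod_const, card_range, ← mul_pow, sS, pow_add]
  ring

theorem Good.PP_eq {L N : ℕ} {μ : ℕ → ℕ} (h : Good L N μ) :
    PP L N μ * X ^ (∑ p ∈ cells μ, hook μ p) =
      E0 L N * X ^ (N * ∑ i ∈ range L, μ i) * (-1) ^ (∑ i ∈ range L, μ i) *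
        (Hp L N μ * Hn L N μ) := by
  rw [← h.E_eq, ← h.cells_const, ← Finset.prod_pow_eq_pow_sum, h.prod_cells', h.prod_cells',
    Hp, Hn, PP]
  simp only [← Finset.prod_mul_distrib]
  refine Finset.prod_congr rfl fun i hi => Finset.prod_congr rfl fun j hj => ?_
  rcases h.cmp (i := i) (j := j) (mem_range.1 hi) with ⟨h1, h2, h3⟩ | hh
  · rw [if_pos h2, if_pos h2, if_pos h2, if_neg (by omega), h3]
    have : sS L μ i = tT L μ j + hook μ (i, j) := by omega
    rw [this, pow_add]; ring
  · rw [if_neg (by omega), if_neg (by omega), if_neg (by omega), if_pos hh.2]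
    have : tT L μ j = sS L μ i + (tT L μ j - sS L μ i) := by omega
    generalize tT L μ j - sS L μ i = d at *
    rw [this, pow_add]; ring

def term (L N M : ℕ) (μ : ℕ → ℕ) : PowerSeries ℤ :=
  (-1 : PowerSeries ℤ) ^ (∑ i ∈ range L, μ i)
          * (X : PowerSeries ℤ) ^
              (M * (∑ i ∈ range L, μ i)
                + ∑ p ∈ cells μ, hook μ p)
          * ∏ p ∈ cells μ,
              ((1 - (X : PowerSeries ℤ) ^ (L + p.2 - p.1))
                * (1 - (X : PowerSeries ℤ) ^ (N + p.1 - p.2))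
                * Ring.inverse ((1 - (X : PowerSeries ℤ) ^ hook μ p) ^ 2))

theorem Good.hook_pos {L N : ℕ} {μ : ℕ → ℕ} (h : Good L N μ) {p : ℕ × ℕ} (hp : p ∈ cells μ) :
    0 < hook μ p := by
  rw [h.mem_cells] at hp
  have := (lt_conj L μ h.anti (h.zero L le_rfl) p.1 p.2).2 hp
  unfold hook; omega

theorem Good.term_eq {L N : ℕ} {μ : ℕ → ℕ} (h : Good L N μ) (M : ℕ) :
    term L N M μ * PP L N μ = P0 L N * X ^ ((M + N) * ∑ i ∈ range L, μ i) := by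
  have hinv : (∏ p ∈ cells μ, Ring.inverse ((gq (hook μ p)) ^ 2)) * Hp L N μ ^ 2 = 1 := by
    rw [← h.Hp_eq, ← Finset.prod_pow, ← Finset.prod_mul_distrib]
    refine Finset.prod_eq_one fun p hp => ?_
    exact Ring.inverse_mul_cancel _ ((gq_unit (h.hook_pos hp)).pow 2)
  have hs : ((-1 : PowerSeries ℤ) ^ (∑ i ∈ range L, μ i)) * (-1) ^ (∑ i ∈ range L, μ i) = 1 := by
    rw [← mul_pow]; simp
  have h1 := h.PP_eq
  have h2 := h.main
  rw [term, P0_eq]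
  simp only [Finset.prod_mul_distrib]
  change _ * (( ∏ p ∈ cells μ, gq (L + p.2 - p.1)) * (∏ p ∈ cells μ, gq (N + p.1 - p.2)) *
    ∏ p ∈ cells μ, Ring.inverse ((gq (hook μ p)) ^ 2)) * _ = _
  rw [pow_add, add_mul, pow_add]
  generalize (∏ p ∈ cells μ, Ring.inverse ((gq (hook μ p)) ^ 2)) = I at *
  generalize (∏ p ∈ cells μ, gq (L + p.2 - p.1)) = K1 at *
  generalize (∏ p ∈ cells μ, gq (N + p.1 - p.2)) = K2 at *
  generalize (-1 : PowerSeries ℤ) ^ (∑ i ∈ range L, μ i) = sg at *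
  generalize (X : PowerSeries ℤ) ^ (∑ p ∈ cells μ, hook μ p) = XH at *
  generalize (X : PowerSeries ℤ) ^ (N * ∑ i ∈ range L, μ i) = XN at *
  generalize (X : PowerSeries ℤ) ^ (M * ∑ i ∈ range L, μ i) = XM at *
  generalize Hp L N μ = H at *
  generalize Hn L N μ = H' at *
  linear_combination sg * XM * K1 * K2 * I * h1 + XM * K1 * K2 * I * E0 L N * XN * H * H' * hs
    + XM * I * E0 L N * XN * H * h2 + XM * E0 L N * XN * Q0 L N * hinv

theorem X_pow_inj' {a b : ℕ} (h : (X : PowerSeries ℤ) ^ a = X ^ b) : a = b := by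
  have := congrArg (PowerSeries.coeff a) h
  rw [coeff_X_pow, coeff_X_pow, if_pos rfl] at this
  by_contra hh
  rw [if_neg hh] at this
  exact one_ne_zero this

theorem Good.PP_ne {L N : ℕ} {μ : ℕ → ℕ} (h : Good L N μ) : PP L N μ ≠ 0 := by
  rw [PP, Finset.prod_ne_zero_iff]
  intro i hi
  rw [Finset.prod_ne_zero_iff]
  intro j hj hh
  have h1 := X_pow_inj' (sub_eq_zero.1 hh)
  rcases h.cmp (i := i) (j := j) (mem_range.1 hi) with hh | hh <;> omega

theorem good_ext {L N : ℕ} {f : Fin L → Fin (N+1)} (h : Antitone (extFun L N f)) :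
    Good L N (extFun L N f) where
  anti := h
  zero i hi := by simp [extFun, hi]
  le i := by
    unfold extFun
    split_ifs
    · have := (f ⟨i, by assumption⟩).2; omega
    · omega

theorem strict_gap {L : ℕ} (p : Fin L → ℕ) (h : StrictMono p) :
    ∀ (d : ℕ) (i : ℕ) (hi : i + d < L), p ⟨i, by omega⟩ + d ≤ p ⟨i + d, hi⟩ := by
  intro d
  induction d with
  | zero => intro i hi; exact le_rfl
  | succ d ih =>
    intro i hi
    have h1 := ih i (by omega)
    have h2 := h (show (⟨i + d, by omega⟩ : Fin L) < ⟨i + (d + 1), hi⟩ by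
      rw [Fin.lt_def]; simp)
    omega

/-- subset attached to a tuple -/
def setOf' (L N : ℕ) (f : Fin L → Fin (N+1)) : Finset (Fin (L+N)) :=
  univ.image (fun i : Fin L => ⟨sS L (extFun L N f) i, by
    have : extFun L N f i ≤ N := by simp [extFun]; omega
    have := i.2
    unfold sS; omega⟩)

theorem set_inj {L N : ℕ} {f g : Fin L → Fin (N+1)} (hf : Antitone (extFun L N f))
    (hg : Antitone (extFun L N g)) (h : setOf' L N f = setOf' L N g) : f = g := by
  have mono : ∀ f : Fin L → Fin (N+1), ∀ hf : Antitone (extFun L N f),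
      StrictMono (fun i : Fin L => (⟨sS L (extFun L N f) i.rev, (good_ext hf).s_lt i.rev.2⟩ :
        Fin (L+N))) := by
    intro f hf i j hij
    exact (good_ext hf).s_anti (Fin.lt_def.1 (Fin.rev_lt_rev.2 hij)) i.rev.2
  have mem : ∀ f : Fin L → Fin (N+1), ∀ hf : Antitone (extFun L N f), ∀ i : Fin L,
      (⟨sS L (extFun L N f) i.rev, (good_ext hf).s_lt i.rev.2⟩ : Fin (L+N)) ∈ setOf' L N f := by
    intro f hf i
    exact Finset.mem_image.2 ⟨i.rev, mem_univ _, rfl⟩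
  have hc : (setOf' L N f).card = L := by
    rw [setOf', Finset.card_image_of_injective, card_univ, Fintype.card_fin]
    intro x y hxy
    have := (mono f hf).injective (a₁ := x.rev) (a₂ := y.rev) (by simpa using hxy)
    simpa using this
  have e1 := Finset.orderEmbOfFin_unique hc (mem f hf) (mono f hf)
  have e2 := Finset.orderEmbOfFin_unique hc (fun i => h ▸ mem g hg i) (mono g hg)
  have e3 := e1.trans e2.symm
  funext i
  have := congrFun e3 i.rev
  simp only [Fin.rev_rev, Fin.mk.injEq, sS, extFun, i.2, dif_pos] at this
  apply Fin.ext
  simpa using this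

theorem set_surj {L N : ℕ} (S : Finset (Fin (L+N))) (hS : S.card = L) :
    ∃ f : Fin L → Fin (N+1), Antitone (extFun L N f) ∧ setOf' L N f = S := by
  set o := S.orderEmbOfFin hS with ho
  have hm : StrictMono (fun i : Fin L => (o i : ℕ)) := fun i j hij => Fin.lt_def.1 (o.strictMono hij)
  have gap := strict_gap _ hm
  have lo : ∀ i : Fin L, (i : ℕ) ≤ o i := by
    intro i
    have := gap i 0 (by omega)
    simp only [zero_add, Fin.eta] at this
    omega
  have hi : ∀ i : Fin L, (o i : ℕ) ≤ N + i := by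
    intro i
    have h1 := gap (L - 1 - i) i (by omega)
    have := (o ⟨i + (L - 1 - i), by omega⟩).2
    simp only [Fin.eta] at h1
    omega
  let f : Fin L → Fin (N+1) := fun i => ⟨o i.rev - (L - 1 - i), by
    have := hi i.rev
    rw [Fin.val_rev] at this
    omega⟩
  have hs : ∀ i : Fin L, sS L (extFun L N f) i = o i.rev := by
    intro i
    have := lo i.rev
    rw [Fin.val_rev] at this
    simp only [sS, extFun, i.2, dif_pos, f]
    simp only [Fin.eta]
    omega
  refine ⟨f, ?_, ?_⟩
  · intro i j hij
    by_cases hj : j < L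
    · have h1 := hs ⟨i, by omega⟩
      have h2 := hs ⟨j, hj⟩
      simp only [sS] at h1 h2
      have h3 := gap (j - i) (L - (j + 1)) (by omega)
      have e1 : (⟨L - (j + 1) + (j - i), by omega⟩ : Fin L) = Fin.rev ⟨i, by omega⟩ := by
        apply Fin.ext; rw [Fin.val_rev]; dsimp only; omega
      have e2 : (⟨L - (j + 1), by omega⟩ : Fin L) = Fin.rev ⟨j, hj⟩ := by
        apply Fin.ext; rw [Fin.val_rev]
      rw [e1, e2] at h3
      omega
    · have : extFun L N f j = 0 := by simp [extFun, hj]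
      omega
  · apply Finset.eq_of_subset_of_card_le
    · intro x hx
      obtain ⟨i, -, rfl⟩ := Finset.mem_image.1 hx
      have : (⟨sS L (extFun L N f) i, by rw [hs]; exact (o i.rev).2⟩ : Fin (L+N)) = o i.rev :=
        Fin.ext (hs i)
      rw [this]
      exact Finset.orderEmbOfFin_mem S hS _
    · rw [hS, setOf', Finset.card_image_of_injective, card_univ, Fintype.card_fin]
      intro x y hxy
      simp only [Fin.mk.injEq] at hxy
      rw [hs, hs] at hxy
      have := o.injective (Fin.ext hxy)
      simpa using this

theorem vand_scale (n : ℕ) (w : PowerSeries ℤ) (x : Fin n → PowerSeries ℤ) :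
    (Matrix.vandermonde (fun i => w * x i)).det =
      (∏ j ∈ range n, w ^ j) * (Matrix.vandermonde x).det := by
  rw [Finset.prod_range, ← Matrix.det_mul_row]
  congr 1
  ext i j
  simp [Matrix.vandermonde_apply, mul_pow]

theorem Good.blk_eq {L N : ℕ} {f : Fin L → Fin (N+1)} (hf : Antitone (extFun L N f)) (M : ℕ) :
    term L N M (extFun L N f) *
      ((Matrix.vandermonde (fun s : Fin (L+N) => (X : PowerSeries ℤ) ^ (s : ℕ))).det *
      ∏ j ∈ range L, ((X : PowerSeries ℤ) ^ (M + N)) ^ j) =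
    P0 L N * (blk L N (fun s => (X : PowerSeries ℤ) ^ (s : ℕ))
      (fun s => ((X : PowerSeries ℤ) ^ (M + N)) ^ (s : ℕ)) (setOf' L N f)).det := by
  have h := good_ext hf
  have h1 : ∀ i : Fin L, ((h.perm (Fin.castAdd N i) : Fin (L+N)) : ℕ) = sS L (extFun L N f) i := by
    intro i; simp [Good.perm, Good.fn]
  have h2 : ∀ i : Fin N, ((h.perm (Fin.natAdd L i) : Fin (L+N)) : ℕ) = tT L (extFun L N f) i := by
    intro i; simp [Good.perm, Good.fn]
  have key := blk_eval L N (fun s => (X : PowerSeries ℤ) ^ (s : ℕ))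
      (fun s => ((X : PowerSeries ℤ) ^ (M + N)) ^ (s : ℕ)) (setOf' L N f) h.perm
      (by
        intro i
        exact Finset.mem_image.2 ⟨i, mem_univ _, Fin.ext (h1 i).symm⟩)
      (by
        intro j hj
        obtain ⟨i, -, hi⟩ := Finset.mem_image.1 hj
        have := congrArg Fin.val hi
        rw [h2] at this
        dsimp only at this
        rcases h.cmp (i := i) (j := j) i.2 with hh | hh <;> omega)
  simp only [h1, h2] at key
  have hP : PP L N (extFun L N f) = ∏ i : Fin L, ∏ j : Fin N,
      ((X : PowerSeries ℤ) ^ tT L (extFun L N f) j - X ^ sS L (extFun L N f) i) := by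
    rw [PP, Finset.prod_range]
    refine Finset.prod_congr rfl fun i _ => ?_
    rw [Finset.prod_range]
  have hW : ∏ i : Fin L, ((X : PowerSeries ℤ) ^ (M + N)) ^ (sS L (extFun L N f) i) =
      X ^ ((M + N) * ∑ i ∈ range L, extFun L N f i) *
        ∏ j ∈ range L, ((X : PowerSeries ℤ) ^ (M + N)) ^ j := by
    rw [← Finset.prod_range (fun i => ((X : PowerSeries ℤ) ^ (M + N)) ^ (sS L (extFun L N f) i)),
      pow_mul, ← Finset.prod_pow_eq_pow_sum, 
      ← Finset.prod_range_reflect (fun j => ((X : PowerSeries ℤ) ^ (M + N)) ^ j),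
      ← Finset.prod_mul_distrib]
    simp only [sS, pow_add]
  rw [← hP, hW] at key
  have ht := h.term_eq M
  apply mul_right_cancel₀ h.PP_ne
  linear_combination ((Matrix.vandermonde (fun s : Fin (L+N) => (X : PowerSeries ℤ) ^ (s : ℕ))).det *
      ∏ j ∈ range L, ((X : PowerSeries ℤ) ^ (M + N)) ^ j) * ht - P0 L N * key

theorem rhs_eq (L N M : ℕ) :
    (∏ n ∈ range N, ∏ l ∈ range L, (1 - (X : PowerSeries ℤ) ^ (n + l + M + 1))) *
      (∏ j ∈ range N, ((X : PowerSeries ℤ) ^ L) ^ j) =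
    ∏ i : Fin L, ∏ j : Fin N, ((X : PowerSeries ℤ) ^ (j : ℕ) - X ^ (M + N) * X ^ (i : ℕ)) := by
  rw [Finset.prod_comm (s := (univ : Finset (Fin L))),
    ← Finset.prod_range_reflect (fun n => ∏ l ∈ range L, (1 - (X : PowerSeries ℤ) ^ (n + l + M + 1))),
    ← Finset.prod_mul_distrib, Finset.prod_range]
  refine Finset.prod_congr rfl fun j _ => ?_
  rw [← pow_mul, mul_comm L, pow_mul]
  have : ((X : PowerSeries ℤ) ^ (j : ℕ)) ^ L = ∏ i ∈ range L, (X : PowerSeries ℤ) ^ (j : ℕ) := by simp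
  rw [this, ← Finset.prod_mul_distrib, Finset.prod_range]
  refine Finset.prod_congr rfl fun i _ => ?_
  rw [sub_mul, one_mul, ← pow_add, ← pow_add]
  congr 2
  omega

/-- for positive integers `L, N, M`,
`Σ_{μ : ℓ(μ) ≤ L, μ₁ ≤ N} (−1)^{|μ|} q^{M|μ| + Σ_{(i,j)∈μ} h(i,j)}
   ∏_{(i,j)∈μ} (1−q^{L+c(i,j)})(1−q^{N−c(i,j)})/(1−q^{h(i,j)})²
 = ∏_{1≤n≤N} ∏_{1≤l≤L} (1 − q^{n+l+M−1})` in `ℤ[[q]]`,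
the sum running over partitions whose Young diagram fits in the `L×N` rectangle
(encoded as antitone tuples `Fin L → Fin (N+1)`). -/
theorem stmt6 (L N M : ℕ) (hL : 0 < L) (hN : 0 < N) (hM : 0 < M) :
    (∑ f : Fin L → Fin (N + 1),
      if Antitone (extFun L N f) then
        (-1 : PowerSeries ℤ) ^ (∑ i ∈ range L, extFun L N f i)
          * (X : PowerSeries ℤ) ^
              (M * (∑ i ∈ range L, extFun L N f i)
                + ∑ p ∈ cells (extFun L N f), hook (extFun L N f) p)
          * ∏ p ∈ cells (extFun L N f),
              ((1 - (X : PowerSeries ℤ) ^ (L + p.2 - p.1))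
                * (1 - (X : PowerSeries ℤ) ^ (N + p.1 - p.2))
                * Ring.inverse ((1 - (X : PowerSeries ℤ) ^ hook (extFun L N f) p) ^ 2))
      else 0)
      = ∏ n ∈ range N, ∏ l ∈ range L, (1 - (X : PowerSeries ℤ) ^ (n + l + M + 1)) := by
  set V := (Matrix.vandermonde (fun s : Fin (L+N) => (X : PowerSeries ℤ) ^ (s : ℕ))).det with hV
  set W := ∏ j ∈ range L, ((X : PowerSeries ℤ) ^ (M + N)) ^ j with hW
  have hV0 : V ≠ 0 := by
    rw [hV, Matrix.det_vandermonde_ne_zero_iff]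
    intro x y hxy
    exact Fin.ext (X_pow_inj' hxy)
  have hW0 : W ≠ 0 := by
    rw [hW, Finset.prod_ne_zero_iff]
    intro j _
    exact pow_ne_zero _ (pow_ne_zero _ X_ne_zero)
  apply mul_right_cancel₀ (mul_ne_zero hV0 hW0)
  set Δ1 := (Matrix.vandermonde (fun s : Fin L => (X : PowerSeries ℤ) ^ (s : ℕ))).det with hΔ1
  set Δ2 := (Matrix.vandermonde (fun s : Fin N => (X : PowerSeries ℤ) ^ (s : ℕ))).det with hΔ2
  have hP0 : P0 L N = ∏ i : Fin L, ∏ j : Fin N,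
      ((X : PowerSeries ℤ) ^ L * X ^ (j : ℕ) - X ^ (i : ℕ)) := by
    rw [P0, Finset.prod_range]
    refine Finset.prod_congr rfl fun i _ => ?_
    rw [Finset.prod_range]
    simp only [pow_add]
  have hVe : V = Δ1 * ((∏ j ∈ range N, ((X : PowerSeries ℤ) ^ L) ^ j) * Δ2) * P0 L N := by
    rw [hΔ2, ← vand_scale, hP0, ← vand_append, hV]
    congr 2
    funext s
    refine Fin.addCases (fun i => ?_) (fun i => ?_) s <;> simp [pow_add]
  have hR : ∑ S, (blk L N (fun s => (X : PowerSeries ℤ) ^ (s : ℕ))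
      (fun s => ((X : PowerSeries ℤ) ^ (M + N)) ^ (s : ℕ)) S).det = W * Δ1 * Δ2 *
      ∏ i : Fin L, ∏ j : Fin N, ((X : PowerSeries ℤ) ^ (j : ℕ) - X ^ (M + N) * X ^ (i : ℕ)) := by
    rw [← blk_sum, hW, hΔ1, ← vand_scale, ← vand_append, ← Matrix.det_transpose]
    congr 1
    ext i s
    refine Fin.addCases (fun i => ?_) (fun i => ?_) i <;>
      simp [Matrix.vandermonde_apply, mul_pow, ← pow_mul, mul_comm]
  have hsum : ∑ S, (blk L N (fun s => (X : PowerSeries ℤ) ^ (s : ℕ))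
      (fun s => ((X : PowerSeries ℤ) ^ (M + N)) ^ (s : ℕ)) S).det =
      ∑ f ∈ univ.filter (fun f : Fin L → Fin (N+1) => Antitone (extFun L N f)),
        (blk L N (fun s => (X : PowerSeries ℤ) ^ (s : ℕ))
        (fun s => ((X : PowerSeries ℤ) ^ (M + N)) ^ (s : ℕ)) (setOf' L N f)).det := by
    symm
    rw [← Finset.sum_image (g := setOf' L N) (f := fun S => (blk L N
      (fun s => (X : PowerSeries ℤ) ^ (s : ℕ))
      (fun s => ((X : PowerSeries ℤ) ^ (M + N)) ^ (s : ℕ)) S).det)]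
    · apply Finset.sum_subset (Finset.subset_univ _)
      intro S _ hS
      by_contra hne
      obtain ⟨f, hf, rfl⟩ := set_surj S (blk_zero L N _ _ S hne)
      exact hS (Finset.mem_image_of_mem _ (by simpa using hf))
    · intro f hf g hg hfg
      exact set_inj (by simpa using hf) (by simpa using hg) hfg
  have hmain : (∑ f : Fin L → Fin (N + 1),
      if Antitone (extFun L N f) then term L N M (extFun L N f) else 0) * (V * W) =
      P0 L N * (W * Δ1 * Δ2 *
      ∏ i : Fin L, ∏ j : Fin N, ((X : PowerSeries ℤ) ^ (j : ℕ) - X ^ (M + N) * X ^ (i : ℕ))) := by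
    rw [← hR, hsum, ← Finset.sum_filter, Finset.sum_mul, Finset.mul_sum]
    refine Finset.sum_congr rfl fun f hf => ?_
    exact Good.blk_eq (by simpa using hf) M
  refine Eq.trans hmain ?_
  rw [← rhs_eq, hVe]
  ring

end
end

section
/- Let μ be a partition with Frobenius notation (m₁,…,m_r | n₁,…,n_r), r ≥ 1, and let μ̃ = (m₂,…,m_r | n₂,…,n_r) be the partition obtained from μ by removing its first principal hook (the cells of μ in the first row or first column). Let N, L be integers with N ≥ μ₁ and L ≥ μᵗ₁. Then the skew plane partition generating functions satisfy Z_{N,L,μ} = Z_{N,L,μ̃} · ∏_{(i,j)∈μ, i=1 or j=1} (1 − q^{N−c(i,j)})(1 − q^{L+c(i,j)}) / (1 − q^{h_μ(i,j)}), where contents and hook lengths are computed in μ. -/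
open Finset PowerSeries

noncomputable section

/-- The (0-indexed) cell `(i, j)` lies in the skew shape `(N×L) ∖ μᵗ`, i.e. (1-indexed)
`1 ≤ i ≤ N`, `1 ≤ j ≤ L`, `j > μᵗ_i`; here `μt i = μᵗ_{i+1}`. -/
def InShape (N L : ℕ) (μt : ℕ → ℕ) (i j : ℕ) : Prop := i < N ∧ μt i ≤ j ∧ j < L

/-- A skew plane partition of shape `(N×L) ∖ μᵗ`: nonnegative entries on the cells of the
shape (zero outside), weakly decreasing along rows and columns within the shape. -/
def IsSkewPP (N L : ℕ) (μt : ℕ → ℕ) (π : ℕ → ℕ → ℕ) : Prop :=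
  (∀ i j, ¬ InShape N L μt i j → π i j = 0) ∧
  (∀ i j, InShape N L μt i j → InShape N L μt i (j + 1) → π i (j + 1) ≤ π i j) ∧
  (∀ i j, InShape N L μt i j → InShape N L μt (i + 1) j → π (i + 1) j ≤ π i j)

/-- The size of a plane partition supported in the `N × L` rectangle. -/
def ppSize (N L : ℕ) (π : ℕ → ℕ → ℕ) : ℕ := ∑ i ∈ range N, ∑ j ∈ range L, π i j

/-- `Z N L μ ∈ ℤ[[q]]`: the generating function `Σ_π q^{|π|}` over skew plane partitions of
shape `(N×L) ∖ μᵗ`. -/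
def Z (N L : ℕ) (μ : ℕ → ℕ) : PowerSeries ℤ :=
  PowerSeries.mk fun n =>
    (Nat.card {π : ℕ → ℕ → ℕ // IsSkewPP N L (conj μ) π ∧ ppSize N L π = n} : ℤ)


/-! ### Part 1: the toggle bijection -/

/-- Skew plane partitions, simplified. -/
def PPs (N L : ℕ) (ν : ℕ → ℕ) (π : ℕ → ℕ → ℕ) : Prop :=
  (∀ i j, ¬ InShape N L ν i j → π i j = 0) ∧
  (∀ i j, ν i ≤ j → π i (j + 1) ≤ π i j ∧ π (i + 1) j ≤ π i j)

lemma pps_iff (N L : ℕ) (ν : ℕ → ℕ) (π : ℕ → ℕ → ℕ) :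
    IsSkewPP N L ν π ↔ PPs N L ν π := by
  constructor
  · rintro ⟨h0, h1, h2⟩
    refine ⟨h0, fun i j hij => ⟨?_, ?_⟩⟩
    · by_cases hs : InShape N L ν i (j + 1)
      · exact h1 i j ⟨hs.1, hij, by have := hs.2.2; omega⟩ hs
      · rw [h0 _ _ hs]; exact Nat.zero_le _
    · by_cases hs : InShape N L ν (i + 1) j
      · exact h2 i j ⟨by have := hs.1; omega, hij, hs.2.2⟩ hs
      · rw [h0 _ _ hs]; exact Nat.zero_le _
  · rintro ⟨h0, h1⟩
    exact ⟨h0, fun i j h _ => (h1 i j h.2.1).1, fun i j h _ => (h1 i j h.2.1).2⟩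

def tog (a b : ℕ) (π : ℕ → ℕ → ℕ) (v : ℕ) : ℕ → ℕ → ℕ := fun i j =>
  if i + b = j + a then
    (if i = a then v else if a < i then
      min (π (i - 1) j) (π i (j - 1)) + max (π (i + 1) j) (π i (j + 1)) - π i j else 0)
  else π i j

lemma tog_off (a b : ℕ) (π : ℕ → ℕ → ℕ) (v i j : ℕ) (h : i + b ≠ j + a) :
    tog a b π v i j = π i j := by simp [tog, h]

lemma tog_corner (a b : ℕ) (π : ℕ → ℕ → ℕ) (v : ℕ) :
    tog a b π v a b = v := by simp [tog, add_comm]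

lemma tog_lt (a b : ℕ) (π : ℕ → ℕ → ℕ) (v i j : ℕ) (h : i + b = j + a) (hi : i < a) :
    tog a b π v i j = 0 := by
  have h1 : i ≠ a := by omega
  have h2 : ¬ a < i := by omega
  simp [tog, h, h1, h2]

lemma tog_diag (a b : ℕ) (π : ℕ → ℕ → ℕ) (v t : ℕ) :
    tog a b π v (a + t + 1) (b + t + 1) =
      min (π (a + t) (b + t + 1)) (π (a + t + 1) (b + t)) +
      max (π (a + t + 1 + 1) (b + t + 1)) (π (a + t + 1) (b + t + 1 + 1)) -
      π (a + t + 1) (b + t + 1) := by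
  have h : a + t + 1 + b = b + t + 1 + a := by omega
  have h1 : a + t + 1 ≠ a := by omega
  have h2 : a < a + t + 1 := by omega
  unfold tog
  rw [if_pos h, if_neg h1, if_pos h2]
  rfl

/-- Case analysis on cell position. -/
lemma cell_cases (a b i j : ℕ) : (i + b ≠ j + a) ∨ (i = a ∧ j = b) ∨ (i + b = j + a ∧ i < a) ∨
    ∃ t, i = a + t + 1 ∧ j = b + t + 1 := by
  by_cases h : i + b = j + a
  · rcases lt_trichotomy i a with h1 | h1 | h1
    · exact Or.inr (Or.inr (Or.inl ⟨h, h1⟩))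
    · exact Or.inr (Or.inl ⟨h1, by omega⟩)
    · exact Or.inr (Or.inr (Or.inr ⟨i - a - 1, by omega, by omega⟩))
  · exact Or.inl h

/-- Context data: `(a,b)` is the first cell (in row-major order) of the shape. -/
structure Ctx (N L : ℕ) (ν : ℕ → ℕ) (a b : ℕ) : Prop where
  anti : Antitone ν
  ha : a < N
  hb : b < L
  hνa : ν a = b
  hlt : ∀ i, i < a → L ≤ ν i

lemma Ctx.anti' {N L ν a b} (c : Ctx N L ν a b) : Antitone (Function.update ν a (b + 1)) := by
  intro i j hij
  have h := c.anti hij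
  have h1 := c.hνa
  have h2 := c.hb
  by_cases hi : i = a <;> by_cases hj : j = a
  · subst hi; subst hj; simp
  · subst hi; simp [hj]; omega
  · subst hj; simp [hi]; have := c.hlt i (by omega); omega
  · simp [hi, hj, h]

lemma tog_bounds {N L ν a b} (c : Ctx N L ν a b) (π : ℕ → ℕ → ℕ)
    (h : ∀ i j, Function.update ν a (b + 1) i ≤ j → π i (j + 1) ≤ π i j ∧ π (i + 1) j ≤ π i j)
    (t : ℕ) :
    π (a + t + 1) (b + t + 1) ≤ min (π (a + t) (b + t + 1)) (π (a + t + 1) (b + t)) ∧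
    max (π (a + t + 1 + 1) (b + t + 1)) (π (a + t + 1) (b + t + 1 + 1)) ≤
      π (a + t + 1) (b + t + 1) := by
  have e1 : ν (a + t + 1) ≤ b := by rw [← c.hνa]; exact c.anti (by omega)
  have e2 : Function.update ν a (b + 1) (a + t + 1) ≤ b := by
    rw [Function.update_of_ne (by omega)]; exact e1
  have e3 : Function.update ν a (b + 1) (a + t) ≤ b + 1 := by
    have := c.anti' (show a ≤ a + t by omega)
    simpa using this
  have k1 := (h (a + t) (b + t + 1) (by omega)).2
  have k2 := (h (a + t + 1) (b + t) (by omega)).1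
  have k3 := h (a + t + 1) (b + t + 1) (by omega)
  exact ⟨le_min k1 k2, max_le k3.2 k3.1⟩

lemma tog_ineq {N L ν a b} (c : Ctx N L ν a b) (π : ℕ → ℕ → ℕ)
    (h0 : ∀ i j, ¬ InShape N L ν i j → π i j = 0)
    (h : ∀ i j, Function.update ν a (b + 1) i ≤ j → π i (j + 1) ≤ π i j ∧ π (i + 1) j ≤ π i j)
    (v : ℕ) (i j : ℕ) (hij : Function.update ν a (b + 1) i ≤ j) :
    tog a b π v i (j + 1) ≤ tog a b π v i j ∧ tog a b π v (i + 1) j ≤ tog a b π v i j := by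
  have hb := c.hb
  have hνa := c.hνa
  have hia : i < a → L ≤ j := by
    intro hi
    rw [Function.update_of_ne (by omega)] at hij
    have := c.hlt i hi; omega
  have hie : i = a → b + 1 ≤ j := by
    intro hi; subst hi; simpa using hij
  obtain ⟨k1, k2⟩ := h i j hij
  rcases cell_cases a b i j with hd | ⟨rfl, rfl⟩ | ⟨hd, hi⟩ | ⟨t, rfl, rfl⟩
  · rw [tog_off _ _ _ _ _ _ hd]
    constructor
    · rcases cell_cases a b i (j + 1) with hd' | ⟨h1, h2⟩ | ⟨hd', hi⟩ | ⟨t, rfl, h2⟩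
      · rwa [tog_off _ _ _ _ _ _ hd']
      · have := hie h1; omega
      · rw [tog_lt _ _ _ _ _ _ hd' hi]; exact Nat.zero_le _
      · obtain rfl : j = b + t := by omega
        rw [tog_diag]
        have := tog_bounds c π h t
        omega
    · rcases cell_cases a b (i + 1) j with hd' | ⟨h1, h2⟩ | ⟨hd', hi⟩ | ⟨t, h2, rfl⟩
      · rwa [tog_off _ _ _ _ _ _ hd']
      · have := hia (by omega); omega
      · rw [tog_lt _ _ _ _ _ _ hd' hi]; exact Nat.zero_le _
      · obtain rfl : i = a + t := by omega
        rw [tog_diag]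
        have := tog_bounds c π h t
        omega
  · have := hie rfl; omega
  · have hj := hia hi
    omega
  · have := tog_bounds c π h t
    rw [tog_off _ _ _ _ _ _ (show a + t + 1 + b ≠ b + t + 1 + 1 + a by omega),
      tog_off _ _ _ _ _ _ (show a + t + 1 + 1 + b ≠ b + t + 1 + a by omega), tog_diag]
    omega

lemma inShape_update {N L ν a b} (c : Ctx N L ν a b) (i j : ℕ) :
    InShape N L ν i j ↔ (i = a ∧ j = b) ∨ InShape N L (Function.update ν a (b + 1)) i j := by
  have := c.ha
  have := c.hb
  have := c.hνa
  unfold InShape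
  by_cases hi : i = a
  · subst hi; simp; omega
  · simp [hi]

lemma not_inShape_update {N L ν a b} (c : Ctx N L ν a b) :
    ¬ InShape N L (Function.update ν a (b + 1)) a b := by
  simp [InShape]

lemma tog_supp {N L ν a b} (c : Ctx N L ν a b) (π : ℕ → ℕ → ℕ)
    (h0 : ∀ i j, ¬ InShape N L ν i j → π i j = 0)
    (v : ℕ) (i j : ℕ) (hij : ¬ InShape N L ν i j) : tog a b π v i j = 0 := by
  have ha := c.ha
  have hb := c.hb
  have hνa := c.hνa
  rcases cell_cases a b i j with hd | ⟨rfl, rfl⟩ | ⟨hd, hi⟩ | ⟨t, rfl, rfl⟩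
  · rw [tog_off _ _ _ _ _ _ hd, h0 _ _ hij]
  · exact absurd ⟨ha, hνa.le, hb⟩ hij
  · rw [tog_lt _ _ _ _ _ _ hd hi]
  · have e1 : ν (a + t + 1) ≤ b := by rw [← c.hνa]; exact c.anti (by omega)
    have hout : N ≤ a + t + 1 ∨ L ≤ b + t + 1 := by
      unfold InShape at hij; omega
    rw [tog_diag, h0 _ _ hij, h0 (a + t + 1 + 1) (b + t + 1) (by unfold InShape; omega),
      h0 (a + t + 1) (b + t + 1 + 1) (by unfold InShape; omega)]
    rcases hout with h | h
    · rw [h0 (a + t + 1) (b + t) (by unfold InShape; omega)]; simp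
    · rw [h0 (a + t) (b + t + 1) (by unfold InShape; omega)]; simp

lemma tog_mem_small {N L ν a b} (c : Ctx N L ν a b) (π : ℕ → ℕ → ℕ) (h : PPs N L ν π) :
    PPs N L (Function.update ν a (b + 1)) (tog a b π 0) := by
  have hle : ∀ i, ν i ≤ Function.update ν a (b + 1) i := by
    intro i
    have := c.hνa
    by_cases hi : i = a
    · subst hi; simp; omega
    · simp [hi]
  refine ⟨fun i j hij => ?_, tog_ineq c π h.1 (fun i j hij => h.2 i j ((hle i).trans hij)) 0⟩
  by_cases hs : InShape N L ν i j
  · rcases (inShape_update c i j).1 hs with ⟨rfl, rfl⟩ | h'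
    · exact tog_corner _ _ _ _
    · exact absurd h' hij
  · exact tog_supp c π h.1 0 i j hs

lemma tog_mem_big {N L ν a b} (c : Ctx N L ν a b) (π : ℕ → ℕ → ℕ)
    (h : PPs N L (Function.update ν a (b + 1)) π) (k : ℕ) :
    PPs N L ν (tog a b π (max (π (a + 1) b) (π a (b + 1)) + k)) := by
  have h0 : ∀ i j, ¬ InShape N L ν i j → π i j = 0 := fun i j hij =>
    h.1 i j fun h' => hij ((inShape_update c i j).2 (Or.inr h'))
  refine ⟨tog_supp c π h0 _, fun i j hij => ?_⟩
  by_cases hs : i = a ∧ j = b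
  · obtain ⟨rfl, rfl⟩ := hs
    rw [tog_corner, tog_off _ _ _ _ _ _ (by omega), tog_off _ _ _ _ _ _ (by omega)]
    omega
  · refine tog_ineq c π h0 h.2 _ i j ?_
    have := c.hνa
    by_cases hi : i = a
    · subst hi; simp; omega
    · simpa [hi] using hij

lemma tog_tog {N L ν a b} (c : Ctx N L ν a b) (π : ℕ → ℕ → ℕ)
    (h0 : ∀ i j, ¬ InShape N L ν i j → π i j = 0)
    (h : ∀ i j, Function.update ν a (b + 1) i ≤ j → π i (j + 1) ≤ π i j ∧ π (i + 1) j ≤ π i j)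
    (v : ℕ) : tog a b (tog a b π v) (π a b) = π := by
  have hb := c.hb
  funext i j
  rcases cell_cases a b i j with hd | ⟨rfl, rfl⟩ | ⟨hd, hi⟩ | ⟨t, rfl, rfl⟩
  · rw [tog_off _ _ _ _ _ _ hd, tog_off _ _ _ _ _ _ hd]
  · rw [tog_corner]
  · rw [tog_lt _ _ _ _ _ _ hd hi, h0]
    have := c.hlt i hi
    unfold InShape; omega
  · have := tog_bounds c π h t
    rw [tog_diag, tog_diag, tog_off _ _ _ _ _ _ (by omega), tog_off _ _ _ _ _ _ (by omega),
      tog_off _ _ _ _ _ _ (by omega), tog_off _ _ _ _ _ _ (by omega)]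
    omega

/-- The toggle equivalence. -/
def togEquiv {N L ν a b} (c : Ctx N L ν a b) :
    {π // PPs N L ν π} ≃ {π // PPs N L (Function.update ν a (b + 1)) π} × ℕ where
  toFun π := (⟨tog a b π.1 0, tog_mem_small c π.1 π.2⟩,
    π.1 a b - max (π.1 (a + 1) b) (π.1 a (b + 1)))
  invFun x := ⟨_, tog_mem_big c x.1.1 x.1.2 x.2⟩
  left_inv := by
    rintro ⟨π, h⟩
    apply Subtype.ext
    have hνa := c.hνa
    have hk := h.2 a b hνa.le
    have hle : ∀ i, ν i ≤ Function.update ν a (b + 1) i := by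
      intro i
      by_cases hi : i = a
      · subst hi; simp; omega
      · simp [hi]
    have := tog_tog c π h.1 (fun i j hij => h.2 i j ((hle i).trans hij)) 0
    simp only
    rw [tog_off _ _ _ _ _ _ (by omega), tog_off _ _ _ _ _ _ (by omega)]
    rwa [Nat.add_sub_cancel' (max_le hk.2 hk.1)]
  right_inv := by
    rintro ⟨⟨π, h⟩, k⟩
    have h0 : ∀ i j, ¬ InShape N L ν i j → π i j = 0 := fun i j hij =>
      h.1 i j fun h' => hij ((inShape_update c i j).2 (Or.inr h'))
    have hz : π a b = 0 := h.1 _ _ (not_inShape_update c)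
    ext1
    · apply Subtype.ext
      have := tog_tog c π h0 h.2 (max (π (a + 1) b) (π a (b + 1)) + k)
      rwa [hz] at this
    · simp only
      rw [tog_corner, tog_off _ _ _ _ _ _ (by omega), tog_off _ _ _ _ _ _ (by omega)]
      omega

/-- sums along a diagonal -/
lemma diag_sum (N L a b : ℕ) (g : ℕ → ℕ → ℕ) (hg : ∀ i j, (N ≤ i ∨ L ≤ j) → g i j = 0)
    (hl : ∀ i j, i + b = j + a → i < a → g i j = 0) (M : ℕ) (hM : N + L ≤ M) :
    ∑ p ∈ range N ×ˢ range L, (if p.1 + b = p.2 + a then (g p.1 p.2 : ℤ) else 0) =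
      ∑ t ∈ range M, (g (a + t) (b + t) : ℤ) := by
  symm
  apply Finset.sum_bij_ne_zero (fun t _ _ => (a + t, b + t))
  · intro t _ ht
    by_contra hc
    apply ht
    rw [hg]; · rfl
    simp at hc; omega
  · intro t _ _ t' _ _ h
    simp at h; omega
  · rintro ⟨i, j⟩ hm h
    simp only [ne_eq, ite_eq_right_iff, Classical.not_imp] at h
    simp at hm
    have : a ≤ i := by
      by_contra hc
      exact h.2 (by rw [hl i j h.1 (by omega)]; rfl)
    refine ⟨i - a, by simp; omega, ?_, ?_⟩
    · have e1 : a + (i - a) = i := by omega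
      have e2 : b + (i - a) = j := by omega
      rw [e1, e2]; exact h.2
    · simp; omega
  · intro t _ _
    simp; omega

lemma tog_trace {N L ν a b} (c : Ctx N L ν a b) (π : ℕ → ℕ → ℕ)
    (h : PPs N L (Function.update ν a (b + 1)) π) (k : ℕ) :
    ∑ p ∈ range N ×ˢ range L, (if p.1 + b = p.2 + a then
        (tog a b π (max (π (a + 1) b) (π a (b + 1)) + k) p.1 p.2 : ℤ) else 0) +
    ∑ p ∈ range N ×ˢ range L, (if p.1 + b = p.2 + a then (π p.1 p.2 : ℤ) else 0) =
    ∑ p ∈ range N ×ˢ range L, (if p.1 + (b + 1) = p.2 + a then (π p.1 p.2 : ℤ) else 0) +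
    ∑ p ∈ range N ×ˢ range L, (if p.1 + b = p.2 + (a + 1) then (π p.1 p.2 : ℤ) else 0) + k := by
  have h0 : ∀ i j, ¬ InShape N L ν i j → π i j = 0 := fun i j hij =>
    h.1 i j fun h' => hij ((inShape_update c i j).2 (Or.inr h'))
  have hbig := tog_mem_big c π h k
  have hb := c.hb
  have hνa := c.hνa
  have hz : π a b = 0 := h.1 _ _ (not_inShape_update c)
  have hlow : ∀ i j, i < a → π i j = 0 := by
    intro i j hi
    apply h0
    have := c.hlt i hi
    unfold InShape; omega
  have hout : ∀ i j, (N ≤ i ∨ L ≤ j) → π i j = 0 := by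
    intro i j hi
    apply h0
    unfold InShape; omega
  set π' := tog a b π (max (π (a + 1) b) (π a (b + 1)) + k) with hπ'
  have hlow' : ∀ i j, i < a → π' i j = 0 := by
    intro i j hi
    apply hbig.1
    have := c.hlt i hi
    unfold InShape; omega
  have hout' : ∀ i j, (N ≤ i ∨ L ≤ j) → π' i j = 0 := by
    intro i j hi
    apply hbig.1
    unfold InShape; omega
  rw [diag_sum N L a b π' hout' (fun i j _ hi => hlow' i j hi) (N + L + 1) (by omega),
    diag_sum N L a b π hout (fun i j _ hi => hlow i j hi) (N + L + 1) (by omega),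
    diag_sum N L a (b + 1) π hout (fun i j _ hi => hlow i j hi) (N + L) (by omega),
    diag_sum N L (a + 1) b π hout ?_ (N + L) (by omega)]
  swap
  · intro i j e hi
    rcases Nat.lt_succ_iff_lt_or_eq.1 hi with h1 | h1
    · exact hlow i j h1
    · apply h.1
      subst h1
      unfold InShape
      simp; omega
  have key : ∀ t, (π' (a + (t + 1)) (b + (t + 1)) : ℤ) + π (a + (t + 1)) (b + (t + 1)) =
      min (π (a + t) (b + 1 + t) : ℤ) (π (a + 1 + t) (b + t)) +
      max (π (a + (t + 1)) (b + 1 + (t + 1)) : ℤ) (π (a + 1 + (t + 1)) (b + (t + 1))) := by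
    intro t
    have hbd := tog_bounds c π h.2 t
    have := tog_diag a b π (max (π (a + 1) b) (π a (b + 1)) + k) t
    rw [← hπ'] at this
    have e1 : b + 1 + t = b + t + 1 := by omega
    have e2 : a + 1 + t = a + t + 1 := by omega
    have e3 : b + 1 + (t + 1) = b + t + 1 + 1 := by omega
    have e4 : a + 1 + (t + 1) = a + t + 1 + 1 := by omega
    rw [e1, e2, e3, e4, ← add_assoc, ← add_assoc]
    omega
  have hc : (π' (a + 0) (b + 0) : ℤ) + π (a + 0) (b + 0) =
      max (π (a + 0) (b + 1 + 0) : ℤ) (π (a + 1 + 0) (b + 0)) + k := by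
    simp only [add_zero, hz]
    rw [hπ', tog_corner]
    push_cast
    rw [max_comm]
    ring
  rw [← Finset.sum_add_distrib, Finset.sum_range_succ', hc, Finset.sum_congr rfl (fun t _ => key t),
    Finset.sum_add_distrib]
  have hM := Finset.sum_range_succ' (fun t => max (π (a + t) (b + 1 + t) : ℤ) (π (a + 1 + t) (b + t)))
    (N + L)
  rw [Finset.sum_range_succ, hout (a + (N + L)) _ (by omega), hout (a + 1 + (N + L)) _ (by omega)]
    at hM
  have hmm : ∀ t ∈ range (N + L), min (π (a + t) (b + 1 + t) : ℤ) (π (a + 1 + t) (b + t)) +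
      max (π (a + t) (b + 1 + t) : ℤ) (π (a + 1 + t) (b + t)) =
      (π (a + t) (b + 1 + t) : ℤ) + (π (a + 1 + t) (b + t)) := fun t _ => min_add_max _ _
  have hsum := Finset.sum_congr rfl hmm
  rw [Finset.sum_add_distrib, Finset.sum_add_distrib] at hsum
  simp only [Nat.cast_zero, max_self, add_zero] at hM hsum ⊢
  linarith

/-! ### Part 2: the weighted bijection and the product formula -/

def Gal (ν κ : ℕ → ℕ) : Prop := ∀ i j, j < ν i ↔ i < κ j

lemma Gal.anti {ν κ : ℕ → ℕ} (h : Gal ν κ) : Antitone ν := by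
  intro i j hij
  by_contra hc
  have h1 := (h j (ν i)).1 (by omega)
  have h2 := (h i (ν i)).2 (by omega)
  omega

lemma Gal.update {ν κ : ℕ → ℕ} (h : Gal ν κ) {N L a b : ℕ} (c : Ctx N L ν a b) :
    Gal (Function.update ν a (b + 1)) (Function.update κ b (a + 1)) := by
  intro i j
  have := c.hνa
  have hb := c.hb
  by_cases hi : i = a <;> by_cases hj : j = b
  · subst hi; subst hj; simp
  · subst hi; simp [hj]; rw [← h]; omega
  · subst hj; simp [hi]
    rcases lt_trichotomy i a with h1 | h1 | h1
    · have := c.hlt i h1; omega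
    · omega
    · have := c.anti h1.le; omega
  · simp [hi, hj]; exact h i j

/-- functions supported on the shape -/
def FS (N L : ℕ) (ν : ℕ → ℕ) (f : ℕ × ℕ → ℕ) : Prop :=
  ∀ p : ℕ × ℕ, ¬ InShape N L ν p.1 p.2 → f p = 0

def fsEquiv {N L ν a b} (c : Ctx N L ν a b) :
    {f // FS N L ν f} ≃ {f // FS N L (Function.update ν a (b + 1)) f} × ℕ where
  toFun f := (⟨Function.update f.1 (a, b) 0, by
    intro p hp
    by_cases h : p = (a, b)
    · subst h; simp
    · rw [Function.update_of_ne h]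
      apply f.2
      rw [inShape_update c]
      rintro (⟨h1, h2⟩ | h')
      · exact h (Prod.ext h1 h2)
      · exact hp h'⟩, f.1 (a, b))
  invFun x := ⟨Function.update x.1.1 (a, b) x.2, by
    intro p hp
    rw [inShape_update c] at hp
    push Not at hp
    have h : p ≠ (a, b) := by
      rintro rfl
      exact hp.1 rfl rfl
    rw [Function.update_of_ne h]
    exact x.1.2 p hp.2⟩
  left_inv := by
    rintro ⟨f, h⟩
    apply Subtype.ext
    simp
  right_inv := by
    rintro ⟨⟨f, h⟩, k⟩
    ext1
    · apply Subtype.ext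
      have hz : f (a, b) = 0 := h _ (not_inShape_update c)
      simp only [Function.update_idem]
      rw [← hz, Function.update_eq_self]
    · simp

def lhsW (N L : ℕ) (y : ℤ → ℤ) (π : ℕ → ℕ → ℕ) : ℤ :=
  ∑ p ∈ range N ×ˢ range L, (y ((p.2 : ℤ) - p.1 + 1) - y ((p.2 : ℤ) - p.1)) * π p.1 p.2

def rhsW (N L : ℕ) (ν κ : ℕ → ℕ) (y : ℤ → ℤ) (f : ℕ × ℕ → ℕ) : ℤ :=
  ∑ p ∈ range N ×ˢ range L, (y ((p.2 : ℤ) + 1 - κ p.2) - y ((ν p.1 : ℤ) - p.1)) * f p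

lemma lhsW_step {N L ν a b} (c : Ctx N L ν a b) (y : ℤ → ℤ) (π : ℕ → ℕ → ℕ)
    (h : PPs N L (Function.update ν a (b + 1)) π) (k : ℕ) :
    lhsW N L y (tog a b π (max (π (a + 1) b) (π a (b + 1)) + k)) =
    lhsW N L (y ∘ Equiv.swap ((b : ℤ) - a) ((b : ℤ) - a + 1)) π +
      (y ((b : ℤ) - a + 1) - y ((b : ℤ) - a)) * k := by
  have ht := tog_trace c π h k
  set π' := tog a b π (max (π (a + 1) b) (π a (b + 1)) + k) with hπ'
  set w := y ((b : ℤ) - a + 1) - y ((b : ℤ) - a) with hw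
  have hterm : ∀ p ∈ range N ×ˢ range L,
      (y ((p.2 : ℤ) - p.1 + 1) - y ((p.2 : ℤ) - p.1)) * (π' p.1 p.2 : ℤ) =
      ((y ∘ Equiv.swap ((b : ℤ) - a) ((b : ℤ) - a + 1)) ((p.2 : ℤ) - p.1 + 1) -
       (y ∘ Equiv.swap ((b : ℤ) - a) ((b : ℤ) - a + 1)) ((p.2 : ℤ) - p.1)) * (π p.1 p.2 : ℤ) +
      w * ((if p.1 + b = p.2 + a then (π' p.1 p.2 : ℤ) else 0) +
        (if p.1 + b = p.2 + a then (π p.1 p.2 : ℤ) else 0) -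
        (if p.1 + (b + 1) = p.2 + a then (π p.1 p.2 : ℤ) else 0) -
        (if p.1 + b = p.2 + (a + 1) then (π p.1 p.2 : ℤ) else 0)) := by
    rintro ⟨i, j⟩ -
    simp only [Function.comp]
    by_cases h1 : i + b = j + a
    · have e : (j : ℤ) - i = (b : ℤ) - a := by omega
      have h2 : ¬ (i + (b + 1) = j + a) := by omega
      have h3 : ¬ (i + b = j + (a + 1)) := by omega
      rw [if_pos h1, if_pos h1, if_neg h2, if_neg h3, e, Equiv.swap_apply_left,
        Equiv.swap_apply_right, hw]
      ring
    · have e0 : π' i j = π i j := tog_off _ _ _ _ _ _ h1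
      rw [if_neg h1, if_neg h1, e0]
      by_cases h2 : i + (b + 1) = j + a
      · have e : (j : ℤ) - i = (b : ℤ) - a + 1 := by omega
        have h3 : ¬ (i + b = j + (a + 1)) := by omega
        rw [if_pos h2, if_neg h3, e, Equiv.swap_apply_right,
          Equiv.swap_apply_of_ne_of_ne (by omega) (by omega), hw]
        ring
      · rw [if_neg h2]
        by_cases h3 : i + b = j + (a + 1)
        · have e : (j : ℤ) - i = (b : ℤ) - a - 1 := by omega
          rw [if_pos h3, e, sub_add_cancel, Equiv.swap_apply_left,
            Equiv.swap_apply_of_ne_of_ne (by omega) (by omega), hw]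
          ring
        · rw [if_neg h3, Equiv.swap_apply_of_ne_of_ne (by omega) (by omega),
            Equiv.swap_apply_of_ne_of_ne (by omega) (by omega)]
          ring
  unfold lhsW
  rw [Finset.sum_congr rfl hterm, Finset.sum_add_distrib, ← Finset.mul_sum,
    Finset.sum_sub_distrib, Finset.sum_sub_distrib, Finset.sum_add_distrib, ht]
  ring

lemma rhsW_step {N L ν κ a b} (hG : Gal ν κ) (c : Ctx N L ν a b) (y : ℤ → ℤ) (f : ℕ × ℕ → ℕ)
    (h : f (a, b) = 0) (k : ℕ) :
    rhsW N L ν κ y (Function.update f (a, b) k) =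
    rhsW N L (Function.update ν a (b + 1)) (Function.update κ b (a + 1))
      (y ∘ Equiv.swap ((b : ℤ) - a) ((b : ℤ) - a + 1)) f +
      (y ((b : ℤ) - a + 1) - y ((b : ℤ) - a)) * k := by
  have hνa := c.hνa
  have hb := c.hb
  have ha := c.ha
  have hκb : κ b = a := by
    have h1 : ¬ a < κ b := by rw [← hG]; omega
    by_contra hc
    have h2 := (hG (κ b) b).1 (by have := c.hlt (κ b) (by omega); omega)
    omega
  have hterm : ∀ p ∈ range N ×ˢ range L,
      (y ((p.2 : ℤ) + 1 - κ p.2) - y ((ν p.1 : ℤ) - p.1)) * (Function.update f (a, b) k p : ℤ) =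
      ((y ∘ Equiv.swap ((b : ℤ) - a) ((b : ℤ) - a + 1))
          ((p.2 : ℤ) + 1 - (Function.update κ b (a + 1) p.2 : ℕ)) -
        (y ∘ Equiv.swap ((b : ℤ) - a) ((b : ℤ) - a + 1))
          (((Function.update ν a (b + 1) p.1 : ℕ) : ℤ) - p.1)) * (f p : ℤ) +
      (if p = (a, b) then (y ((b : ℤ) - a + 1) - y ((b : ℤ) - a)) * k else 0) := by
    rintro ⟨i, j⟩ hp
    simp only [Finset.mem_product, Finset.mem_range] at hp
    have e1 : (y ∘ Equiv.swap ((b : ℤ) - a) ((b : ℤ) - a + 1))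
          ((j : ℤ) + 1 - (Function.update κ b (a + 1) j : ℕ)) = y ((j : ℤ) + 1 - κ j) := by
      simp only [Function.comp]
      by_cases hj : j = b
      · subst hj
        rw [Function.update_self, hκb]
        have e : (j : ℤ) + 1 - ((a + 1 : ℕ) : ℤ) = (j : ℤ) - a := by push_cast; ring
        rw [e, Equiv.swap_apply_left]
        congr 1; ring
      · rw [Function.update_of_ne hj]
        have hg := hG a j
        have hne : (j : ℤ) + 1 - κ j < (b : ℤ) - a ∨ (b : ℤ) - a + 1 < (j : ℤ) + 1 - κ j := by
          omega
        rw [Equiv.swap_apply_of_ne_of_ne (by omega) (by omega)]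
    have e2 : (y ∘ Equiv.swap ((b : ℤ) - a) ((b : ℤ) - a + 1))
          (((Function.update ν a (b + 1) i : ℕ) : ℤ) - i) = y ((ν i : ℤ) - i) := by
      simp only [Function.comp]
      by_cases hi : i = a
      · subst hi
        rw [Function.update_self, hνa]
        have e : ((b + 1 : ℕ) : ℤ) - i = (b : ℤ) - i + 1 := by push_cast; ring
        rw [e, Equiv.swap_apply_right]
      · rw [Function.update_of_ne hi]
        have hne : (ν i : ℤ) - i < (b : ℤ) - a ∨ (b : ℤ) - a + 1 < (ν i : ℤ) - i := by
          rcases lt_or_gt_of_ne hi with h1 | h1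
          · have := c.hlt i h1; omega
          · have := c.anti h1.le; omega
        rw [Equiv.swap_apply_of_ne_of_ne (by omega) (by omega)]
    simp only [e1, e2]
    by_cases hij : (i, j) = (a, b)
    · rw [if_pos hij, hij]
      simp only [Prod.mk.injEq] at hij
      obtain ⟨rfl, rfl⟩ := hij
      rw [Function.update_self, h, hκb, hνa]
      have e : (j : ℤ) + 1 - i = j - i + 1 := by ring
      rw [e]; simp
    · rw [if_neg hij, Function.update_of_ne hij, add_zero]
  unfold rhsW
  rw [Finset.sum_congr rfl hterm, Finset.sum_add_distrib, Finset.sum_ite_eq', if_pos]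
  simp [ha, hb]

lemma master (N L : ℕ) : ∀ (n : ℕ) (ν κ : ℕ → ℕ), Gal ν κ → ∑ i ∈ range N, (L - ν i) = n →
    ∃ e : {π // PPs N L ν π} ≃ {f // FS N L ν f},
      ∀ π (y : ℤ → ℤ), lhsW N L y π.1 = rhsW N L ν κ y (e π).1 := by
  intro n
  induction n with
  | zero =>
    intro ν κ hG hn
    have hs : ∀ i j, ¬ InShape N L ν i j := by
      intro i j h
      have h1 := h.1
      have h2 := h.2
      have := (Finset.sum_eq_zero_iff.1 hn) i (by simpa using h1)
      omega
    refine ⟨⟨fun _ => ⟨fun _ => 0, fun _ _ => rfl⟩,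
      fun _ => ⟨fun _ _ => 0, fun _ _ _ => rfl, fun _ _ _ => ⟨le_rfl, le_rfl⟩⟩, ?_, ?_⟩, ?_⟩
    · rintro ⟨π, h⟩
      apply Subtype.ext
      funext i j
      exact (h.1 i j (hs i j)).symm
    · rintro ⟨f, h⟩
      apply Subtype.ext
      funext p
      exact (h p (hs _ _)).symm
    · rintro ⟨π, h⟩ y
      have : π = fun _ _ => 0 := by
        funext i j
        exact h.1 i j (hs i j)
      subst this
      simp [lhsW, rhsW]
  | succ n ih =>
    intro ν κ hG hn
    have hex : ∃ i, i < N ∧ ν i < L := by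
      by_contra hc
      push Not at hc
      have : ∑ i ∈ range N, (L - ν i) = 0 := Finset.sum_eq_zero (fun i hi => by
        have := hc i (by simpa using hi); omega)
      omega
    classical
    obtain ⟨ha1, ha2⟩ := Nat.find_spec hex
    have hmin := fun i (hi : i < Nat.find hex) => Nat.find_min hex hi
    set a := Nat.find hex
    obtain ⟨b, hb⟩ : ∃ b, ν a = b := ⟨_, rfl⟩
    have c : Ctx N L ν a b := ⟨hG.anti, ha1, by omega, hb, fun i hi => by
      have := hmin i hi; omega⟩
    have hsum : ∑ i ∈ range N, (L - Function.update ν a (b + 1) i) = n := by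
      have m : a ∈ range N := by simpa using ha1
      rw [← Finset.add_sum_erase _ _ m] at hn ⊢
      rw [Function.update_self, Finset.sum_congr rfl (g := fun i => L - ν i) (fun i hi => by
        rw [Function.update_of_ne (Finset.ne_of_mem_erase hi)])]
      omega
    obtain ⟨e, he⟩ := ih _ _ (hG.update c) hsum
    refine ⟨(togEquiv c).trans ((Equiv.prodCongr e (Equiv.refl ℕ)).trans (fsEquiv c).symm), ?_⟩
    intro π y
    obtain ⟨x, rfl⟩ := (togEquiv c).symm.surjective π
    obtain ⟨π, k⟩ := x
    simp only [Equiv.trans_apply, Equiv.apply_symm_apply, Equiv.prodCongr_apply, Prod.map]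
    have h1 := lhsW_step c y π.1 π.2 k
    have h2 := rhsW_step hG c y (e π).1 ((e π).2 _ (not_inShape_update c)) k
    have h3 := he π (y ∘ Equiv.swap ((b : ℤ) - a) ((b : ℤ) - a + 1))
    rw [h3, ← h2] at h1
    exact h1

lemma geom_aux (h : ℕ) (hh : 0 < h) :
    (PowerSeries.mk fun n => if h ∣ n then (1 : ℤ) else 0) * (1 - (X : PowerSeries ℤ) ^ h) = 1 := by
  ext n
  rw [mul_sub, mul_one, map_sub, PowerSeries.coeff_mul_X_pow', coeff_one]
  simp only [coeff_mk]
  by_cases hn : h ≤ n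
  · rw [if_pos hn, if_neg (show n ≠ 0 by omega)]
    have : h ∣ n - h ↔ h ∣ n := by
      conv_rhs => rw [← Nat.sub_add_cancel hn]
      simp
    simp [this]
  · rw [if_neg hn]
    by_cases h0 : n = 0
    · simp [h0]
    · rw [if_neg h0, if_neg (fun hd => hn (Nat.le_of_dvd (by omega) hd))]; simp

lemma geom_multi {α : Type*} [DecidableEq α] (s : Finset α) (h : α → ℕ) (hh : ∀ x ∈ s, 0 < h x) :
    (PowerSeries.mk fun n => (Nat.card {f : α → ℕ // (∀ x, x ∉ s → f x = 0) ∧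
      ∑ x ∈ s, h x * f x = n} : ℤ)) * ∏ x ∈ s, (1 - (X : PowerSeries ℤ) ^ h x) = 1 := by
  have key : (PowerSeries.mk fun n => (Nat.card {f : α → ℕ // (∀ x, x ∉ s → f x = 0) ∧
      ∑ x ∈ s, h x * f x = n} : ℤ)) =
      ∏ x ∈ s, (PowerSeries.mk fun n => if h x ∣ n then (1 : ℤ) else 0) := by
    ext n
    rw [PowerSeries.coeff_prod]
    simp only [coeff_mk]
    have : ∀ l : α →₀ ℕ, (∏ x ∈ s, if h x ∣ l x then (1 : ℤ) else 0) =
        if (∀ x ∈ s, h x ∣ l x) then 1 else 0 := by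
      intro l
      rw [Finset.prod_ite_zero]
      simp
    simp only [this]
    rw [Finset.sum_boole]
    congr 1
    rw [← Fintype.card_coe, ← Nat.card_eq_fintype_card]
    refine Nat.card_congr ⟨fun f => ⟨Finsupp.onFinset s (fun x => h x * f.1 x) ?_, ?_⟩,
      fun l => ⟨fun x => l.1 x / h x, ?_, ?_⟩, ?_, ?_⟩
    · intro x hx
      by_contra hc
      exact hx (by rw [f.2.1 x hc, mul_zero])
    · rw [Finset.mem_filter, Finset.mem_finsuppAntidiag]
      refine ⟨⟨f.2.2, Finsupp.support_onFinset_subset⟩, fun x _ => ?_⟩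
      exact Dvd.intro _ rfl
    · intro x hx
      have hl := l.2
      rw [Finset.mem_filter, Finset.mem_finsuppAntidiag] at hl
      have : l.1 x = 0 := by
        by_contra hc
        exact hx (hl.1.2 (Finsupp.mem_support_iff.2 hc))
      change l.1 x / h x = 0
      rw [this, Nat.zero_div]
    · have hl := l.2
      rw [Finset.mem_filter, Finset.mem_finsuppAntidiag] at hl
      refine Eq.trans ?_ hl.1.1
      exact Finset.sum_congr rfl (fun x hx => Nat.mul_div_cancel' (hl.2 x hx))
    · rintro ⟨f, hf⟩
      apply Subtype.ext
      funext x
      by_cases hx : x ∈ s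
      · exact Nat.mul_div_cancel_left _ (hh x hx)
      · change h x * f x / h x = f x
        rw [hf.1 x hx, mul_zero, Nat.zero_div]
    · rintro ⟨l, hl⟩
      apply Subtype.ext
      ext x
      rw [Finset.mem_filter, Finset.mem_finsuppAntidiag] at hl
      change h x * (l x / h x) = l x
      by_cases hx : x ∈ s
      · exact Nat.mul_div_cancel' (hl.2 x hx)
      · have : l x = 0 := by
          by_contra hc
          exact hx (hl.1.2 (Finsupp.mem_support_iff.2 hc))
        rw [this, Nat.zero_div, mul_zero]
  rw [key, ← Finset.prod_mul_distrib]
  exact Finset.prod_eq_one (fun x hx => geom_aux _ (hh x hx))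

/-! ### Part 3: the product formula and the comparison -/

def G (x : ℤ) : PowerSeries ℤ := if 0 < x then 1 - X ^ x.toNat else 1

lemma G_nonpos {x : ℤ} (h : x ≤ 0) : G x = 1 := if_neg (by omega)

lemma G_pos {x : ℤ} (h : 0 < x) : G x = 1 - X ^ x.toNat := if_pos h

lemma G_ne_zero (x : ℤ) : G x ≠ 0 := by
  unfold G
  split_ifs with h
  · intro h0
    have := congrArg (PowerSeries.constantCoeff (R := ℤ)) h0
    have hx : x.toNat ≠ 0 := by omega
    rw [map_sub, map_one, map_pow, PowerSeries.constantCoeff_X, zero_pow hx] at this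
    simp at this
  · exact one_ne_zero

lemma Z_formula (N L : ℕ) (μ : ℕ → ℕ) (hG : Gal (conj μ) μ) :
    Z N L μ * ∏ i ∈ range N, ∏ j ∈ range L, G (((i : ℤ) - conj μ i) - ((μ j : ℤ) - j - 1)) = 1 := by
  classical
  set s := (range N ×ˢ range L).filter fun p => conj μ p.1 ≤ p.2 with hs
  set h : ℕ × ℕ → ℕ := fun p => (((p.1 : ℤ) - conj μ p.1) - ((μ p.2 : ℤ) - p.2 - 1)).toNat with hh
  have hpos : ∀ p : ℕ × ℕ, conj μ p.1 ≤ p.2 ↔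
      0 < ((p.1 : ℤ) - conj μ p.1) - ((μ p.2 : ℤ) - p.2 - 1) := by
    intro p
    have := hG p.1 p.2
    omega
  have hmem : ∀ p : ℕ × ℕ, p ∈ s ↔ InShape N L (conj μ) p.1 p.2 := by
    intro p
    simp [hs, InShape]; tauto
  have hgm := geom_multi s h (fun p hp => by
    have := (hpos p).1 (Finset.mem_filter.1 hp).2
    simp only [hh]; omega)
  have hprod : ∏ i ∈ range N, ∏ j ∈ range L, G (((i : ℤ) - conj μ i) - ((μ j : ℤ) - j - 1)) =
      ∏ x ∈ s, (1 - (X : PowerSeries ℤ) ^ h x) := by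
    rw [← Finset.prod_product', hs, Finset.prod_filter]
    apply Finset.prod_congr rfl
    intro p _
    by_cases hp : conj μ p.1 ≤ p.2
    · rw [if_pos hp, G_pos ((hpos p).1 hp)]
    · rw [if_neg hp, G_nonpos]
      have := hpos p
      omega
  rw [hprod]
  refine Eq.trans ?_ hgm
  congr 1
  unfold Z
  congr 1
  funext n
  congr 1
  obtain ⟨e, he⟩ := master N L _ (conj μ) μ hG rfl
  have hsize : ∀ π : {π // PPs N L (conj μ) π}, ppSize N L π.1 = ∑ x ∈ s, h x * (e π).1 x := by
    intro π
    have h1 := he π id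
    have h2 : lhsW N L id π.1 = (ppSize N L π.1 : ℤ) := by
      unfold lhsW ppSize
      rw [← Finset.sum_product']
      push_cast
      apply Finset.sum_congr rfl
      intro p _
      simp
    have h3 : rhsW N L (conj μ) μ id (e π).1 = ((∑ x ∈ s, h x * (e π).1 x : ℕ) : ℤ) := by
      unfold rhsW
      rw [hs, Finset.sum_filter]
      push_cast
      apply Finset.sum_congr rfl
      intro p _
      by_cases hp : conj μ p.1 ≤ p.2
      · rw [if_pos hp]
        have := (hpos p).1 hp
        simp only [hh, id]
        rw [Int.toNat_of_nonneg this.le]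
        ring
      · rw [if_neg hp, (e π).2 p (fun hc => hp hc.2.1)]
        simp
    rw [h2, h3] at h1
    exact_mod_cast h1
  refine Nat.card_congr ⟨fun π => ⟨(e ⟨π.1, (pps_iff _ _ _ _).1 π.2.1⟩).1, ?_, ?_⟩,
    fun f => ⟨(e.symm ⟨f.1, fun p hp => f.2.1 p (by rwa [hmem])⟩).1, ?_, ?_⟩, ?_, ?_⟩
  · intro p hp
    rw [hmem] at hp
    exact (e _).2 p hp
  · rw [← hsize]; exact π.2.2
  · exact (pps_iff _ _ _ _).2 (e.symm _).2
  · rw [hsize]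
    simp only [Equiv.apply_symm_apply]
    exact f.2.2
  · rintro ⟨π, hπ⟩
    apply Subtype.ext
    have := congrArg Subtype.val (e.symm_apply_apply ⟨π, (pps_iff _ _ _ _).1 hπ.1⟩)
    exact this
  · rintro ⟨f, hf⟩
    apply Subtype.ext
    have := congrArg Subtype.val (e.apply_symm_apply ⟨f, fun p hp => hf.1 p (by rwa [hmem])⟩)
    exact this

/-! Abstract product identity -/

lemma prod_up (L N t : ℤ) (h : -L ≤ t) :
    ∏ x ∈ Finset.Ico (-L) N, G (x - t) = ∏ k ∈ Finset.Ico 1 (N - t), G k := by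
  refine Finset.prod_bij_ne_one (fun x _ _ => x - t) ?_ ?_ ?_ ?_
  · intro x hx h1
    have : 0 < x - t := by
      by_contra hc
      exact h1 (G_nonpos (by omega))
    simp at hx ⊢; omega
  · intro x _ _ y _ _ hxy
    simpa using hxy
  · intro k hk h1
    simp at hk
    exact ⟨k + t, by simp; omega, by simpa using h1, by simp⟩
  · intros; rfl

lemma prod_down (L N t : ℤ) (h : t < N) :
    ∏ x ∈ Finset.Ico (-L) N, G (t - x) = ∏ k ∈ Finset.Ico 1 (t + L + 1), G k := by
  refine Finset.prod_bij_ne_one (fun x _ _ => t - x) ?_ ?_ ?_ ?_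
  · intro x hx h1
    have : 0 < t - x := by
      by_contra hc
      exact h1 (G_nonpos (by omega))
    simp at hx ⊢; omega
  · intro x _ _ y _ _ hxy
    simpa using hxy
  · intro k hk h1
    simp at hk
    exact ⟨t - k, by simp; omega, by simpa using h1, by simp⟩
  · intros; rfl

lemma prod_cN (N l m : ℤ) : ∏ x ∈ Finset.Ioc (-l) m, G (N - x) =
    ∏ k ∈ Finset.Ico (N - m) (N + l), G k := by
  refine Finset.prod_nbij' (fun x => N - x) (fun x => N - x) ?_ ?_ ?_ ?_ ?_
  · intro x hx; simp at hx ⊢; omega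
  · intro x hx; simp at hx ⊢; omega
  · intro x _; simp
  · intro x _; simp
  · intro x _; rfl

lemma prod_cL (L l m : ℤ) : ∏ x ∈ Finset.Ioc (-l) m, G (L + x) =
    ∏ k ∈ Finset.Ico (L - l + 1) (L + m + 1), G k := by
  refine Finset.prod_nbij' (fun x => L + x) (fun x => x - L) ?_ ?_ ?_ ?_ ?_
  · intro x hx; simp at hx ⊢; omega
  · intro x hx; simp at hx ⊢; omega
  · intro x _; simp
  · intro x _; simp
  · intro x _; rfl

lemma prod_consec (a b c : ℤ) (h1 : a ≤ b) (h2 : b ≤ c) :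
    (∏ k ∈ Finset.Ico a b, G k) * ∏ k ∈ Finset.Ico b c, G k = ∏ k ∈ Finset.Ico a c, G k := by
  rw [← Finset.prod_union (Finset.Ico_disjoint_Ico_consecutive a b c),
    Finset.Ico_union_Ico_eq_Ico h1 h2]

lemma abstract_id (A C : Finset ℤ) (l m N L : ℤ) (hd : Disjoint A C)
    (hu : A ∪ C = Finset.Ico (-L) N) (hA : -l ∈ A) (hAl : ∀ a ∈ A, -l ≤ a)
    (hC : m ∈ C) (hCm : ∀ c ∈ C, c ≤ m) (hlm : -l < m) :
    (∏ a ∈ A, ∏ c ∈ C, G (a - c)) * ∏ x ∈ Finset.Ioc (-l) m, (G (N - x) * G (L + x)) =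
    (∏ a ∈ insert m (A.erase (-l)), ∏ c ∈ insert (-l) (C.erase m), G (a - c)) *
      (G (m + l) * (∏ a ∈ A.erase (-l), G (m - a)) * ∏ c ∈ C.erase m, G (c + l)) := by
  have hm : m ∈ Finset.Ico (-L) N := by rw [← hu]; exact Finset.mem_union_right _ hC
  have hl : -l ∈ Finset.Ico (-L) N := by rw [← hu]; exact Finset.mem_union_left _ hA
  rw [Finset.mem_Ico] at hm hl
  have hmA : m ∉ A := fun h => Finset.disjoint_left.1 hd h hC
  have hlC : -l ∉ C := fun h => Finset.disjoint_left.1 hd hA h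
  have hmA' : m ∉ A.erase (-l) := fun h => hmA (Finset.mem_of_mem_erase h)
  have hlC' : -l ∉ C.erase m := fun h => hlC (Finset.mem_of_mem_erase h)
  -- split products over the whole interval
  have split : ∀ f : ℤ → PowerSeries ℤ, ∏ x ∈ Finset.Ico (-L) N, f x =
      (f (-l) * ∏ x ∈ A.erase (-l), f x) * (f m * ∏ x ∈ C.erase m, f x) := by
    intro f
    rw [← hu, Finset.prod_union hd, Finset.mul_prod_erase _ _ hA, Finset.mul_prod_erase _ _ hC]
  have s1 := split (fun x => G (x - m))
  have s2 := split (fun x => G (-l - x))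
  have s3 := split (fun x => G (m - x))
  have s4 := split (fun x => G (x - -l))
  rw [prod_up L N m (by omega)] at s1
  rw [prod_down L N (-l) (by omega)] at s2
  rw [prod_down L N m (by omega)] at s3
  rw [prod_up L N (-l) (by omega)] at s4
  have z1 : ∏ x ∈ C.erase m, G (x - m) = 1 := Finset.prod_eq_one (fun x hx =>
    G_nonpos (by have := hCm x (Finset.mem_of_mem_erase hx); omega))
  have z2 : ∏ x ∈ A.erase (-l), G (-l - x) = 1 := Finset.prod_eq_one (fun x hx =>
    G_nonpos (by have := hAl x (Finset.mem_of_mem_erase hx); omega))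
  have g0 : G 0 = 1 := G_nonpos le_rfl
  have g1 : G (-l - m) = 1 := G_nonpos (by omega)
  have em : m - -l = m + l := by ring
  rw [z1, sub_self, g0, g1] at s1
  rw [z2, sub_self, g0, g1] at s2
  rw [sub_self, g0, em] at s3
  rw [sub_self, g0, em] at s4
  have c1 := prod_consec 1 (N - m) (N + l) (by omega) (by omega)
  have c2 := prod_consec 1 (L - l + 1) (L + m + 1) (by omega) (by omega)
  have e2 : -l + L + 1 = L - l + 1 := by ring
  have e3 : m + L + 1 = L + m + 1 := by ring
  have e4 : N - -l = N + l := by ring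
  rw [e2] at s2
  rw [e3] at s3
  rw [e4] at s4
  rw [Finset.prod_mul_distrib, prod_cN, prod_cL]
  rw [← Finset.mul_prod_erase A _ hA, ← Finset.mul_prod_erase C _ hC]
  rw [Finset.prod_insert hmA', Finset.prod_insert hlC']
  have d1 : ∏ a ∈ A.erase (-l), ∏ c ∈ C, G (a - c) = (∏ a ∈ A.erase (-l), G (a - m)) *
      ∏ a ∈ A.erase (-l), ∏ c ∈ C.erase m, G (a - c) := by
    rw [← Finset.prod_mul_distrib]
    exact Finset.prod_congr rfl (fun a _ => (Finset.mul_prod_erase C _ hC).symm)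
  have d2 : ∏ a ∈ A.erase (-l), ∏ c ∈ insert (-l) (C.erase m), G (a - c) =
      (∏ a ∈ A.erase (-l), G (a - -l)) *
      ∏ a ∈ A.erase (-l), ∏ c ∈ C.erase m, G (a - c) := by
    rw [← Finset.prod_mul_distrib]
    exact Finset.prod_congr rfl (fun a _ => Finset.prod_insert hlC')
  have d3 : ∏ c ∈ C.erase m, G (c + l) = ∏ c ∈ C.erase m, G (c - -l) :=
    Finset.prod_congr rfl (fun c _ => by rw [sub_neg_eq_add])
  rw [d1, d2, d3, g1, em]
  set R := ∏ a ∈ A.erase (-l), ∏ c ∈ C.erase m, G (a - c)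
  set a1 := ∏ x ∈ A.erase (-l), G (x - m)
  set a3 := ∏ x ∈ A.erase (-l), G (m - x)
  set a4 := ∏ x ∈ A.erase (-l), G (x - -l)
  set b2 := ∏ x ∈ C.erase m, G (-l - x)
  set b3 := ∏ x ∈ C.erase m, G (m - x)
  set b4 := ∏ x ∈ C.erase m, G (x - -l)
  set P1 := ∏ k ∈ Finset.Ico (N - m) (N + l), G k
  set P2 := ∏ k ∈ Finset.Ico (L - l + 1) (L + m + 1), G k
  rw [s1, s4] at c1
  rw [s2, s3] at c2
  have : a1 * P1 * (b2 * P2) = (a4 * (G (m + l) * b4)) * (G (m + l) * a3 * b3) := by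
    linear_combination (b2 * P2) * c1 + (a4 * (G (m + l) * b4)) * c2
  linear_combination R * this

/-! ### Part 4: assembling -/

lemma gal_conj (μ : ℕ → ℕ) (hμ : IsPartition μ) : Gal (conj μ) μ := by
  obtain ⟨ha, n0, hn0⟩ := hμ
  intro i j
  have hex : ∃ n, μ n < i + 1 := ⟨n0, by omega⟩
  classical
  have h1 := Nat.find_spec hex
  have hmin := fun k (hk : k < Nat.find hex) => Nat.find_min hex hk
  set n := Nat.find hex
  have hset : {k | i + 1 ≤ μ k} = Set.Iio n := by
    ext k
    simp only [Set.mem_ofPred_eq, Set.mem_Iio]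
    constructor
    · intro hk
      by_contra hc
      have := ha (show n ≤ k by omega)
      omega
    · intro hk
      have := hmin k hk
      omega
  have hc : conj μ i = n := by
    unfold conj
    rw [hset, ← Finset.coe_Iio, Set.ncard_coe_finset, Nat.card_Iio]
  rw [hc, ← Set.mem_Iio, ← hset]
  simp only [Set.mem_ofPred_eq]
  omega

def SA (N : ℕ) (ν : ℕ → ℕ) : Finset ℤ := (range N).image fun i : ℕ => (i : ℤ) - ν i
def SC (L : ℕ) (κ : ℕ → ℕ) : Finset ℤ := (range L).image fun j : ℕ => (κ j : ℤ) - j - 1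

lemma SA_inj {ν : ℕ → ℕ} (h : Antitone ν) : Function.Injective fun i : ℕ => (i : ℤ) - ν i := by
  intro i j hij
  simp only at hij
  rcases lt_trichotomy i j with h1 | h1 | h1
  · have := h h1.le; omega
  · exact h1
  · have := h h1.le; omega

lemma SC_inj {κ : ℕ → ℕ} (h : Antitone κ) :
    Function.Injective fun j : ℕ => (κ j : ℤ) - j - 1 := by
  intro i j hij
  simp only at hij
  rcases lt_trichotomy i j with h1 | h1 | h1
  · have := h h1.le; omega
  · exact h1
  · have := h h1.le; omega

lemma SA_card {N : ℕ} {ν : ℕ → ℕ} (h : Antitone ν) : (SA N ν).card = N := by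
  rw [SA, Finset.card_image_of_injective _ (SA_inj h), Finset.card_range]

lemma SC_card {L : ℕ} {κ : ℕ → ℕ} (h : Antitone κ) : (SC L κ).card = L := by
  rw [SC, Finset.card_image_of_injective _ (SC_inj h), Finset.card_range]

lemma Gal.symm' {ν κ : ℕ → ℕ} (h : Gal ν κ) : Gal κ ν := fun i j => (h j i).symm

lemma S_disj {N L : ℕ} {ν κ : ℕ → ℕ} (h : Gal ν κ) : Disjoint (SA N ν) (SC L κ) := by
  rw [Finset.disjoint_left]
  intro x hx hx'
  simp only [SA, SC, Finset.mem_image, Finset.mem_range] at hx hx'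
  obtain ⟨i, _, rfl⟩ := hx
  obtain ⟨j, _, hj⟩ := hx'
  have := h i j
  omega

lemma S_union {N L : ℕ} {ν κ : ℕ → ℕ} (h : Gal ν κ) (h1 : κ 0 ≤ N) (h2 : ν 0 ≤ L) :
    SA N ν ∪ SC L κ = Finset.Ico (-(L : ℤ)) N := by
  apply Finset.eq_of_subset_of_card_le
  · intro x hx
    rw [Finset.mem_Ico]
    rcases Finset.mem_union.1 hx with hx | hx
    · simp only [SA, Finset.mem_image, Finset.mem_range] at hx
      obtain ⟨i, hi, rfl⟩ := hx
      have := h.anti (Nat.zero_le i)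
      omega
    · simp only [SC, Finset.mem_image, Finset.mem_range] at hx
      obtain ⟨i, hi, rfl⟩ := hx
      have := h.symm'.anti (Nat.zero_le i)
      omega
  · rw [Finset.card_union_of_disjoint (S_disj h), SA_card h.anti, SC_card h.symm'.anti, Int.card_Ico]
    omega

lemma D_eq {N L : ℕ} {ν κ : ℕ → ℕ} (h : Gal ν κ) :
    ∏ i ∈ range N, ∏ j ∈ range L, G (((i : ℤ) - ν i) - ((κ j : ℤ) - j - 1)) =
      ∏ a ∈ SA N ν, ∏ c ∈ SC L κ, G (a - c) := by
  rw [SA, Finset.prod_image (fun x _ y _ hxy => SA_inj h.anti hxy)]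
  refine Finset.prod_congr rfl (fun i _ => ?_)
  rw [SC, Finset.prod_image (fun x _ y _ hxy => SC_inj h.symm'.anti hxy)]

lemma SA_tilde {N : ℕ} {ν κ ν' κ' : ℕ → ℕ} (h : Gal ν κ) (h' : Gal ν' κ')
    (hκ : ∀ j, κ' j = κ (j + 1) - 1) (h0 : 1 ≤ κ 0) (h1 : κ 0 ≤ N) :
    SA N ν' = insert ((κ 0 : ℤ) - 1) ((SA N ν).erase (-(ν 0 : ℤ))) := by
  have hν : ∀ i, ν' i = ν (i + 1) - 1 := by
    intro i
    have : ∀ j, j < ν' i ↔ j < ν (i + 1) - 1 := by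
      intro j
      have e1 := h' i j
      have e2 := h (i + 1) (j + 1)
      rw [hκ] at e1
      omega
    have a1 := this (ν' i)
    have a2 := this (ν (i + 1) - 1)
    omega
  apply Finset.eq_of_subset_of_card_le
  · intro x hx
    simp only [SA, Finset.mem_image, Finset.mem_range] at hx
    obtain ⟨i, hi, rfl⟩ := hx
    rw [Finset.mem_insert, Finset.mem_erase]
    have a0 := h.anti (Nat.zero_le i)
    have a1 := h.anti (Nat.zero_le (i + 1))
    have g0 := h i 0
    have g1 := h (i + 1) 0
    have gz := h 0 0
    have hn := hν i
    rcases lt_trichotomy (i + 1) (κ 0) with hlt | heq | hgt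
    · right
      refine ⟨by omega, ?_⟩
      simp only [SA, Finset.mem_image, Finset.mem_range]
      exact ⟨i + 1, by omega, by omega⟩
    · left; omega
    · right
      refine ⟨by omega, ?_⟩
      simp only [SA, Finset.mem_image, Finset.mem_range]
      exact ⟨i, hi, by omega⟩
  · have hm : -(ν 0 : ℤ) ∈ SA N ν := by
      simp only [SA, Finset.mem_image, Finset.mem_range]
      exact ⟨0, by omega, by simp⟩
    refine (Finset.card_insert_le _ _).trans ?_
    rw [Finset.card_erase_of_mem hm, SA_card h.anti, SA_card h'.anti]
    omega

lemma SC_tilde {L : ℕ} {ν κ ν' κ' : ℕ → ℕ} (h : Gal ν κ) (h' : Gal ν' κ')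
    (hκ : ∀ j, κ' j = κ (j + 1) - 1) (h0 : 1 ≤ κ 0) (h2 : ν 0 ≤ L) :
    SC L κ' = insert (-(ν 0 : ℤ)) ((SC L κ).erase ((κ 0 : ℤ) - 1)) := by
  have gz := h 0 0
  apply Finset.eq_of_subset_of_card_le
  · intro x hx
    simp only [SC, Finset.mem_image, Finset.mem_range] at hx
    obtain ⟨i, hi, rfl⟩ := hx
    rw [Finset.mem_insert, Finset.mem_erase]
    have a0 := h.symm'.anti (Nat.zero_le i)
    have a1 := h.symm'.anti (Nat.zero_le (i + 1))
    have g0 := h 0 i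
    have g1 := h 0 (i + 1)
    have hn := hκ i
    rcases lt_trichotomy (i + 1) (ν 0) with hlt | heq | hgt
    · right
      refine ⟨by omega, ?_⟩
      simp only [SC, Finset.mem_image, Finset.mem_range]
      exact ⟨i + 1, by omega, by omega⟩
    · left; omega
    · right
      refine ⟨by omega, ?_⟩
      simp only [SC, Finset.mem_image, Finset.mem_range]
      exact ⟨i, hi, by omega⟩
  · have hm : (κ 0 : ℤ) - 1 ∈ SC L κ := by
      simp only [SC, Finset.mem_image, Finset.mem_range]
      exact ⟨0, by omega, by simp⟩
    refine (Finset.card_insert_le _ _).trans ?_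
    rw [Finset.card_erase_of_mem hm, SC_card h.symm'.anti, SC_card h'.symm'.anti]
    omega

lemma hook_cells_eq (μ : ℕ → ℕ) (hG : Gal (conj μ) μ) (hr : 1 ≤ μ 0) :
    ((cells μ).filter fun p => p.1 = 0 ∨ p.2 = 0) =
      ((range (μ 0)).image fun j => ((0, j) : ℕ × ℕ)) ∪
      ((range (conj μ 0 - 1)).image fun i => ((i + 1, 0) : ℕ × ℕ)) := by
  have gz := hG 0 0
  ext ⟨i, j⟩
  have g1 := hG 0 i
  simp only [cells, Finset.mem_filter, Finset.mem_product, Finset.mem_range, Finset.mem_union,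
    Finset.mem_image, Prod.mk.injEq]
  constructor
  · rintro ⟨⟨⟨h1, h2⟩, h3⟩, h4⟩
    rcases i with _ | i
    · exact Or.inl ⟨j, h2, rfl, rfl⟩
    · exact Or.inr ⟨i, by omega, rfl, by omega⟩
  · rintro (⟨k, hk, rfl, rfl⟩ | ⟨k, hk, rfl, rfl⟩)
    · exact ⟨⟨⟨by omega, hk⟩, hk⟩, Or.inl rfl⟩
    · exact ⟨⟨⟨by omega, by omega⟩, by omega⟩, Or.inr rfl⟩

lemma hook_prod (μ : ℕ → ℕ) (hG : Gal (conj μ) μ) (hr : 1 ≤ μ 0) (F : ℕ × ℕ → PowerSeries ℤ) :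
    ∏ p ∈ (cells μ).filter (fun p => p.1 = 0 ∨ p.2 = 0), F p =
      (∏ j ∈ range (μ 0), F (0, j)) * ∏ i ∈ range (conj μ 0 - 1), F (i + 1, 0) := by
  rw [hook_cells_eq μ hG hr, Finset.prod_union, Finset.prod_image, Finset.prod_image]
  · intro x _ y _ h; simpa using h
  · intro x _ y _ h; simpa using h
  · rw [Finset.disjoint_left]
    intro p h1 h2
    simp only [Finset.mem_image] at h1 h2
    obtain ⟨_, _, rfl⟩ := h1
    obtain ⟨_, _, h⟩ := h2
    simp at h

lemma num_prod (l n : ℕ) (hl : 1 ≤ l) (hn : 1 ≤ n) (F : ℤ → PowerSeries ℤ) :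
    ∏ x ∈ Finset.Ioc (-(l : ℤ)) ((n : ℤ) - 1), F x =
      (∏ j ∈ range n, F j) * ∏ i ∈ range (l - 1), F (-((i : ℤ) + 1)) := by
  have e : Finset.Ioc (-(l : ℤ)) ((n : ℤ) - 1) =
      ((range n).image fun j : ℕ => (j : ℤ)) ∪
      ((range (l - 1)).image fun i : ℕ => (-((i : ℤ) + 1))) := by
    ext x
    simp only [Finset.mem_Ioc, Finset.mem_union, Finset.mem_image, Finset.mem_range]
    constructor
    · intro hx
      by_cases h : 0 ≤ x
      · exact Or.inl ⟨x.toNat, by omega, by omega⟩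
      · exact Or.inr ⟨(-x - 1).toNat, by omega, by omega⟩
    · rintro (⟨k, hk, rfl⟩ | ⟨k, hk, rfl⟩) <;> omega
  rw [e, Finset.prod_union, Finset.prod_image, Finset.prod_image]
  · intro x _ y _ h; simpa using h
  · intro x _ y _ h; simpa using h
  · rw [Finset.disjoint_left]
    intro p h1 h2
    simp only [Finset.mem_image] at h1 h2
    obtain ⟨_, _, rfl⟩ := h1
    obtain ⟨_, _, h⟩ := h2
    omega

lemma row_hooks (N : ℕ) (ν κ : ℕ → ℕ) (h : Gal ν κ) (h0 : 1 ≤ κ 0) (h1 : κ 0 ≤ N) :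
    G ((κ 0 : ℤ) - 1 + ν 0) * (∏ a ∈ (SA N ν).erase (-(ν 0 : ℤ)), G ((κ 0 : ℤ) - 1 - a)) =
    ∏ j ∈ range (κ 0), G ((κ 0 : ℤ) + ν j - (j + 1)) := by
  have hm : -(ν 0 : ℤ) ∈ SA N ν := by
    simp only [SA, Finset.mem_image, Finset.mem_range]
    exact ⟨0, by omega, by simp⟩
  have e : (κ 0 : ℤ) - 1 + ν 0 = (κ 0 : ℤ) - 1 - (-(ν 0 : ℤ)) := by ring
  rw [e, Finset.mul_prod_erase (SA N ν) (fun a => G ((κ 0 : ℤ) - 1 - a)) hm, SA,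
    Finset.prod_image (fun x _ y _ hxy => SA_inj h.anti hxy)]
  symm
  rw [← Finset.prod_subset (Finset.range_subset_range.2 h1)]
  · exact Finset.prod_congr rfl (fun j _ => by congr 1; ring)
  · intro j _ hj
    simp only [Finset.mem_range] at hj
    have := h j 0
    exact G_nonpos (by omega)

lemma col_hooks (L : ℕ) (ν κ : ℕ → ℕ) (h : Gal ν κ) (h0 : 1 ≤ κ 0) (h2 : ν 0 ≤ L) :
    (∏ c ∈ (SC L κ).erase ((κ 0 : ℤ) - 1), G (c + ν 0)) =
    ∏ i ∈ range (ν 0 - 1), G ((κ (i + 1) : ℤ) + ν 0 - (i + 1 + 1)) := by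
  have gz := h 0 0
  have hm : (κ 0 : ℤ) - 1 ∈ SC L κ := by
    simp only [SC, Finset.mem_image, Finset.mem_range]
    exact ⟨0, by omega, by simp⟩
  apply mul_left_cancel₀ (G_ne_zero ((κ 0 : ℤ) - 1 + ν 0))
  rw [Finset.mul_prod_erase (SC L κ) (fun c => G (c + ν 0)) hm, SC,
    Finset.prod_image (fun x _ y _ hxy => SC_inj h.symm'.anti hxy)]
  symm
  rw [← Finset.prod_subset (Finset.range_subset_range.2 h2)]
  · obtain ⟨l, hl⟩ : ∃ l, ν 0 = l + 1 := ⟨ν 0 - 1, by omega⟩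
    rw [hl, Finset.prod_range_succ', Nat.add_sub_cancel, mul_comm]
    congr 1
    · exact Finset.prod_congr rfl (fun j _ => by congr 1; push_cast; ring)
  · intro j _ hj
    simp only [Finset.mem_range] at hj
    have := h 0 j
    exact G_nonpos (by omega)

/-- let `μ` be a partition with Frobenius length `r ≥ 1` (i.e. `μ₁ ≥ 1`), and
let `μ̃` be obtained from `μ` by removing its first principal hook (the cells in the first
row or first column), i.e. `μ̃_i = μ_{i+1} − 1`.  For `N ≥ μ₁` and `L ≥ μᵗ₁`,
`Z_{N,L,μ} = Z_{N,L,μ̃} · ∏_{(i,j)∈μ, i=1 ∨ j=1}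
  (1−q^{N−c(i,j)})(1−q^{L+c(i,j)})/(1−q^{h_μ(i,j)})`. -/
theorem stmt10 (N L : ℕ) (μ : ℕ → ℕ) (hμ : IsPartition μ) (hr : 1 ≤ μ 0)
    (h1 : μ 0 ≤ N) (h2 : conj μ 0 ≤ L) :
    Z N L μ
      = Z N L (fun i => μ (i + 1) - 1)
        * ∏ p ∈ (cells μ).filter fun p => p.1 = 0 ∨ p.2 = 0,
            ((1 - (X : PowerSeries ℤ) ^ (N + p.1 - p.2))
              * (1 - (X : PowerSeries ℤ) ^ (L + p.2 - p.1))
              * Ring.inverse (1 - (X : PowerSeries ℤ) ^ hook μ p)) := by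
  have hG := gal_conj μ hμ
  have hμ' : IsPartition (fun i => μ (i + 1) - 1) := by
    refine ⟨fun i j hij => Nat.sub_le_sub_right (hμ.1 (by omega)) 1, ?_⟩
    obtain ⟨n, hn⟩ := hμ.2
    refine ⟨n, ?_⟩
    have := hμ.1 (Nat.le_succ n)
    change μ (n + 1) ≤ μ n at this
    change μ (n + 1) - 1 = 0
    omega
  have hG' := gal_conj _ hμ'
  have gz := hG 0 0
  have z1 := Z_formula N L μ hG
  have z2 := Z_formula N L _ hG'
  rw [D_eq hG] at z1
  rw [D_eq hG', SA_tilde hG hG' (fun _ => rfl) hr h1, SC_tilde hG hG' (fun _ => rfl) hr h2] at z2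
  have habs := abstract_id (SA N (conj μ)) (SC L μ) (conj μ 0) ((μ 0 : ℤ) - 1) N L (S_disj hG)
    (S_union hG h1 h2)
    (by
      simp only [SA, Finset.mem_image, Finset.mem_range]
      exact ⟨0, by omega, by simp⟩)
    (by
      intro a ha
      simp only [SA, Finset.mem_image, Finset.mem_range] at ha
      obtain ⟨i, hi, rfl⟩ := ha
      have := hG.anti (Nat.zero_le i)
      omega)
    (by
      simp only [SC, Finset.mem_image, Finset.mem_range]
      exact ⟨0, by omega, by simp⟩)
    (by
      intro a ha
      simp only [SC, Finset.mem_image, Finset.mem_range] at ha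
      obtain ⟨i, hi, rfl⟩ := ha
      have := hμ.1 (Nat.zero_le i)
      omega)
    (by omega)
  rw [row_hooks N _ _ hG hr h1, col_hooks L _ _ hG hr h2, num_prod _ _ (by omega) hr] at habs
  -- the hook product
  have hH : ∏ p ∈ (cells μ).filter (fun p => p.1 = 0 ∨ p.2 = 0),
        (1 - (X : PowerSeries ℤ) ^ hook μ p) =
      (∏ j ∈ range (μ 0), G ((μ 0 : ℤ) + conj μ j - (j + 1))) *
      ∏ i ∈ range (conj μ 0 - 1), G ((μ (i + 1) : ℤ) + conj μ 0 - (i + 1 + 1)) := by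
    rw [hook_prod μ hG hr]
    congr 1
    · refine Finset.prod_congr rfl (fun j hj => ?_)
      simp only [Finset.mem_range] at hj
      have := hG j 0
      rw [G_pos (by omega)]
      congr 2
      simp only [hook]
      omega
    · refine Finset.prod_congr rfl (fun j hj => ?_)
      simp only [Finset.mem_range] at hj
      have := hG 0 (j + 1)
      rw [G_pos (by omega)]
      congr 2
      simp only [hook]
      omega
  have hP : ∏ p ∈ (cells μ).filter (fun p => p.1 = 0 ∨ p.2 = 0),
        ((1 - (X : PowerSeries ℤ) ^ (N + p.1 - p.2)) * (1 - (X : PowerSeries ℤ) ^ (L + p.2 - p.1))) =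
      (∏ j ∈ range (μ 0), (G ((N : ℤ) - j) * G ((L : ℤ) + j))) *
      ∏ i ∈ range (conj μ 0 - 1), (G ((N : ℤ) - (-((i : ℤ) + 1))) * G ((L : ℤ) + (-((i : ℤ) + 1)))) := by
    rw [hook_prod μ hG hr]
    congr 1
    · refine Finset.prod_congr rfl (fun j hj => ?_)
      simp only [Finset.mem_range] at hj
      rw [G_pos (by omega), G_pos (by omega)]
      congr 3
      all_goals omega
    · refine Finset.prod_congr rfl (fun j hj => ?_)
      simp only [Finset.mem_range] at hj
      rw [G_pos (by omega), G_pos (by omega)]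
      congr 3
      all_goals omega
  have hinv : (∏ p ∈ (cells μ).filter (fun p => p.1 = 0 ∨ p.2 = 0),
        (1 - (X : PowerSeries ℤ) ^ hook μ p)) *
      (∏ p ∈ (cells μ).filter (fun p => p.1 = 0 ∨ p.2 = 0),
        Ring.inverse (1 - (X : PowerSeries ℤ) ^ hook μ p)) = 1 := by
    rw [← Finset.prod_mul_distrib]
    refine Finset.prod_eq_one (fun p hp => Ring.mul_inverse_cancel _ ?_)
    have hpos : 0 < hook μ p := by
      simp only [cells, Finset.mem_filter] at hp
      have := hG p.2 p.1
      simp only [hook]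
      omega
    exact IsUnit.of_mul_eq_one_right _ (geom_aux _ hpos)
  rw [Finset.prod_mul_distrib]
  rw [← hH, ← hP] at habs
  set P := ∏ p ∈ (cells μ).filter (fun p => p.1 = 0 ∨ p.2 = 0),
        ((1 - (X : PowerSeries ℤ) ^ (N + p.1 - p.2)) * (1 - (X : PowerSeries ℤ) ^ (L + p.2 - p.1)))
  set H := ∏ p ∈ (cells μ).filter (fun p => p.1 = 0 ∨ p.2 = 0),
        (1 - (X : PowerSeries ℤ) ^ hook μ p)
  set I := ∏ p ∈ (cells μ).filter (fun p => p.1 = 0 ∨ p.2 = 0),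
        Ring.inverse (1 - (X : PowerSeries ℤ) ^ hook μ p)
  set Z1 := Z N L μ
  set Z2 := Z N L (fun i => μ (i + 1) - 1)
  linear_combination (Z2 * P * I) * z1 - (Z1 * H * I) * z2 - Z1 * hinv - (Z1 * Z2 * I) * habs

end
end
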